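/- arXiv:1808.03335 — 4 statements merged into one kernel-verified Lean document; each statement's English description precedes it below -/
import Mathlib

section
/- Let γ ∈ (0,1) and let Φ_γ(z) = Σ_{n=0}^∞ (−z)^n / (n! Γ(1 − γ − γn)) be the Wright function. Then for every r > −1, ∫_0^∞ t^r Φ_γ(t) dt = Γ(1+r)/Γ(1+γr). -/
open MeasureTheory

/-- The Wright function `Φ_γ(z) = Σ_{n=0}^∞ (-z)^n / (n! Γ(1 - γ - γn))` (restricted to `ℝ`). -/
noncomputable def wright (γ : ℝ) (t : ℝ) : ℝ :=
  ∑' n : ℕ, (-t) ^ n / (n.factorial * Real.Gamma (1 - γ - γ * n))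


lemma wm_int (a b : ℝ) (ha : 0 < a) (hb : 0 < b) :
    IntegrableOn (fun t : ℝ => t ^ (a - 1) * Real.exp (-(b * t))) (Set.Ioi 0) := by
  have := integrableOn_rpow_mul_exp_neg_mul_rpow (p := 1) (s := a - 1) (b := b)
    (by linarith) one_pos hb
  simpa using this

lemma wm_hasDeriv (a : ℝ) (ha : 0 < a) (w : ℂ) (hw : 0 < w.re) :
    ∃ d, HasDerivAt (fun w : ℂ => ∫ t in Set.Ioi (0:ℝ), ((t ^ (a - 1) : ℝ) : ℂ) *
      Complex.exp (-(w * t))) d w := by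
  refine ⟨_, (hasDerivAt_integral_of_dominated_loc_of_deriv_le
    (F' := fun w t => ((t ^ (a - 1) : ℝ) : ℂ) * (Complex.exp (-(w * t)) * (-(t:ℂ))))
    (bound := fun t => t ^ ((a + 1) - 1) * Real.exp (-((w.re / 2) * t)))
    (s := {z : ℂ | w.re / 2 < z.re})
    ((isOpen_lt continuous_const Complex.continuous_re).mem_nhds
      (by simp only [Set.mem_ofPred_eq]; linarith)) ?_ ?_ ?_ ?_ ?_ ?_).2⟩
  · refine Filter.Eventually.of_forall fun z => Measurable.aestronglyMeasurable ?_
    fun_prop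
  · refine (wm_int a w.re ha hw).mono' (Measurable.aestronglyMeasurable (by fun_prop)) ?_
    refine (ae_restrict_iff' measurableSet_Ioi).2 (Filter.Eventually.of_forall fun t ht => ?_)
    have ht : (0:ℝ) < t := ht
    rw [norm_mul, Complex.norm_real, Complex.norm_exp, Real.norm_of_nonneg (by positivity)]
    simp
  · exact Measurable.aestronglyMeasurable (by fun_prop)
  · refine (ae_restrict_iff' measurableSet_Ioi).2 (Filter.Eventually.of_forall fun t ht z hz => ?_)
    have ht : (0:ℝ) < t := ht
    have hz : w.re / 2 < z.re := hz
    rw [norm_mul, norm_mul, norm_neg, Complex.norm_real, Complex.norm_real, Complex.norm_exp,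
      Real.norm_of_nonneg (by positivity), Real.norm_of_nonneg ht.le]
    have e : t ^ (a + 1 - 1) = t ^ (a - 1) * t := by
      rw [← Real.rpow_add_one ht.ne']; ring_nf
    rw [e]
    have : (-(z * t)).re = -(z.re * t) := by simp
    rw [this]
    have : Real.exp (-(z.re * t)) ≤ Real.exp (-(w.re / 2 * t)) := by
      apply Real.exp_le_exp.2; nlinarith
    calc t ^ (a - 1) * (Real.exp (-(z.re * t)) * t)
        = t ^ (a - 1) * t * Real.exp (-(z.re * t)) := by ring
      _ ≤ _ := by gcongr
  · exact wm_int (a + 1) (w.re / 2) (by linarith) (by linarith)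
  · refine Filter.Eventually.of_forall fun t z _ => ?_
    have h : HasDerivAt (fun z : ℂ => -(z * t)) (-(t:ℂ)) z := by
      have h0 := ((hasDerivAt_id z).mul_const (t:ℂ)).neg
      rw [one_mul] at h0
      exact h0
    exact (h.cexp).const_mul _

lemma wm_gam (a : ℝ) (ha : 0 < a) (w : ℂ) (hw : 0 < w.re) :
    ∫ t in Set.Ioi (0:ℝ), ((t ^ (a - 1) : ℝ) : ℂ) * Complex.exp (-(w * t)) =
      w ^ (-(a:ℂ)) * Real.Gamma a := by
  set U : Set ℂ := {z | 0 < z.re} with hU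
  have hUo : IsOpen U := isOpen_lt continuous_const Complex.continuous_re
  have hUc : IsPreconnected U := (convex_halfSpace_re_gt 0).isPreconnected
  have h1 : AnalyticOnNhd ℂ (fun w : ℂ => ∫ t in Set.Ioi (0:ℝ), ((t ^ (a - 1) : ℝ) : ℂ) *
      Complex.exp (-(w * t))) U := by
    apply DifferentiableOn.analyticOnNhd _ hUo
    intro z hz
    obtain ⟨d, hd⟩ := wm_hasDeriv a ha z hz
    exact hd.differentiableAt.differentiableWithinAt
  have h2 : AnalyticOnNhd ℂ (fun w : ℂ => w ^ (-(a:ℂ)) * (Real.Gamma a : ℂ)) U := by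
    apply DifferentiableOn.analyticOnNhd _ hUo
    intro z hz
    have : z ∈ Complex.slitPlane := Or.inl hz
    exact (((hasDerivAt_id z).cpow_const this).mul_const _).differentiableAt.differentiableWithinAt
  have key : ∀ x : ℝ, 0 < x → ∫ t in Set.Ioi (0:ℝ), ((t ^ (a - 1) : ℝ) : ℂ) *
      Complex.exp (-((x:ℂ) * t)) = (x:ℂ) ^ (-(a:ℂ)) * (Real.Gamma a : ℂ) := by
    intro x hx
    have := Complex.integral_cpow_mul_exp_neg_mul_Ioi (a := a) (r := x) (by simpa using ha) hx
    rw [Complex.Gamma_ofReal] at this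
    rw [Complex.cpow_neg, ← Complex.inv_cpow _ _ (by rw [Complex.arg_ofReal_of_nonneg hx.le]; exact Real.pi_ne_zero.symm),
      ← one_div, ← this]
    refine setIntegral_congr_fun measurableSet_Ioi fun t ht => ?_
    have ht : (0:ℝ) < t := ht
    rw [Complex.ofReal_cpow ht.le]; push_cast; rfl
  refine h1.eqOn_of_preconnected_of_frequently_eq h2 hUc (z₀ := 1) (by simp [hU]) ?_ hw
  have ht : Filter.Tendsto (fun n : ℕ => (((1 + 1 / ((n:ℝ) + 1) : ℝ)) : ℂ)) Filter.atTop (nhdsWithin 1 {1}ᶜ) := by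
    rw [tendsto_nhdsWithin_iff]
    constructor
    · have h := (tendsto_one_div_add_atTop_nhds_zero_nat (𝕜 := ℝ)).const_add 1
      rw [add_zero] at h
      have := (Complex.continuous_ofReal.tendsto 1).comp h
      rw [Complex.ofReal_one] at this
      exact this
    · refine Filter.Eventually.of_forall fun n => ?_
      have : (0:ℝ) < 1 / ((n:ℝ) + 1) := by positivity
      simp only [Set.mem_compl_iff, Set.mem_singleton_iff]
      rw [← Complex.ofReal_one, Complex.ofReal_inj]; linarith
  exact ht.frequently (Filter.Frequently.of_forall fun n => key _ (by positivity))

lemma wm_pow (y c s : ℝ) (hc : 0 < c) (hs : 0 < s) :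
    ∃ K : ℝ, 0 ≤ K ∧ ∀ x : ℝ, s ≤ x → x ^ y ≤ K * Real.exp (c / 2 * x) := by
  rcases le_or_gt y 0 with hy | hy
  · refine ⟨s ^ y, by positivity, fun x hx => ?_⟩
    have h1 : x ^ y ≤ s ^ y := Real.rpow_le_rpow_of_nonpos hs hx hy
    have h2 : 1 ≤ Real.exp (c / 2 * x) := Real.one_le_exp (by
      have : 0 < x := by linarith
      positivity)
    have : 0 ≤ s ^ y := by positivity
    nlinarith
  · refine ⟨(2 * y / c) ^ y, by positivity, fun x hx => ?_⟩
    have hx0 : 0 < x := by linarith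
    have h1 : c / (2 * y) * x ≤ Real.exp (c / (2 * y) * x) := by
      have := Real.add_one_le_exp (c / (2 * y) * x); linarith
    have h2 : x ≤ (2 * y / c) * Real.exp (c / (2 * y) * x) := by
      have e : x = (2 * y / c) * (c / (2 * y) * x) := by field_simp
      calc x = (2 * y / c) * (c / (2 * y) * x) := e
        _ ≤ _ := by gcongr
    calc x ^ y ≤ ((2 * y / c) * Real.exp (c / (2 * y) * x)) ^ y := by gcongr
      _ = _ := by
        rw [Real.mul_rpow (by positivity) (by positivity), ← Real.exp_mul]
        congr 2; field_simp


lemma wm_le {ω : ℂ} (hn : ‖ω‖ = 1) {a ρ : ℝ} (ha : 0 ≤ a) (hρ : 0 ≤ ρ) : ‖(a:ℂ) + ρ * ω‖ ≤ a + ρ := by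
  refine (norm_add_le _ _).trans ?_
  rw [norm_mul, hn, Complex.norm_real, Complex.norm_real, Real.norm_of_nonneg ha,
    Real.norm_of_nonneg hρ, mul_one]

lemma wm_geρ (ω : ℂ) {a ρ : ℝ} : ρ * ω.im ≤ ‖(a:ℂ) + ρ * ω‖ := by
  have := Complex.abs_im_le_norm ((a:ℂ) + ρ * ω)
  simp only [Complex.add_im, Complex.ofReal_im, Complex.mul_im, Complex.ofReal_re, zero_mul,
    add_zero, zero_add] at this
  exact (le_abs_self _).trans this

lemma wm_gea {ω : ℂ} (hn : ‖ω‖ = 1) {a ρ : ℝ} : a * ω.im ≤ ‖(a:ℂ) + ρ * ω‖ := by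
  have := Complex.abs_im_le_norm (((a:ℂ) + ρ * ω) * (starRingEnd ℂ) ω)
  rw [norm_mul, Complex.norm_conj, hn, mul_one] at this
  refine le_trans ?_ this
  refine le_trans (le_of_eq ?_) (neg_le_abs _)
  simp
  ring

lemma wm_slit {ω : ℂ} (hs : 0 < ω.im) {a ρ : ℝ} (ha : 0 < a) (hρ : 0 ≤ ρ) : (a:ℂ) + ρ * ω ∈ Complex.slitPlane := by
  rcases hρ.eq_or_lt with h | h
  · left; simp [← h, ha]
  · right
    have : 0 < ρ * ω.im := by positivity
    simp; exact ⟨h.ne', hs.ne'⟩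

lemma wm_exp {ω : ℂ} (a ρ : ℝ) : ‖Complex.exp ((a:ℂ) + ρ * ω)‖ = Real.exp a * Real.exp (ω.re * ρ) := by
  rw [Complex.norm_exp, ← Real.exp_add]; congr 1; simp; ring

lemma wm_bound {ω : ℂ} (hc : ω.re < 0) (hs : 0 < ω.im) (hn : ‖ω‖ = 1) (y : ℝ) {a : ℝ} (ha : 0 < a) : ∃ C : ℝ, ∀ ρ : ℝ, 0 ≤ ρ →
    ‖Complex.exp ((a:ℂ) + ρ * ω) * ((a:ℂ) + ρ * ω) ^ (y:ℂ)‖ ≤ C * Real.exp (ω.re / 2 * ρ) := by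
  obtain ⟨K, hK, h⟩ := wm_pow y (-ω.re) (a * ω.im) (by linarith) (by positivity)
  refine ⟨Real.exp a * (K * Real.exp (-ω.re / 2 * a)), fun ρ hρ => ?_⟩
  rw [norm_mul, wm_exp, Complex.norm_cpow_real]
  have h1 := h _ (wm_gea hn (a := a) (ρ := ρ))
  have h2 : Real.exp (-ω.re / 2 * ‖(a:ℂ) + ρ * ω‖) ≤ Real.exp (-ω.re / 2 * (a + ρ)) := by
    have := wm_le hn ha.le hρ
    apply Real.exp_le_exp.2
    nlinarith
  calc _ ≤ Real.exp a * Real.exp (ω.re * ρ) * (K * Real.exp (-ω.re / 2 * (a + ρ))) := by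
        gcongr; exact h1.trans (by gcongr)
    _ = Real.exp a * K * (Real.exp (ω.re * ρ) * Real.exp (-ω.re / 2 * (a + ρ))) := by ring
    _ = Real.exp a * K * (Real.exp (-ω.re / 2 * a) * Real.exp (ω.re / 2 * ρ)) := by
        rw [← Real.exp_add, ← Real.exp_add]; congr 2; ring
    _ = _ := by ring

lemma wm_expint {b : ℝ} (hb : b < 0) (C : ℝ) :
    IntegrableOn (fun ρ : ℝ => C * Real.exp (b * ρ)) (Set.Ioi 0) :=
  (integrableOn_exp_mul_Ioi hb 0).const_mul C

lemma wm_integrable {ω : ℂ} (hc : ω.re < 0) (hs : 0 < ω.im) (hn : ‖ω‖ = 1) (y : ℝ) {a : ℝ} (ha : 0 < a) :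
    IntegrableOn (fun ρ : ℝ => Complex.exp ((a:ℂ) + ρ * ω) * ((a:ℂ) + ρ * ω) ^ (y:ℂ))
      (Set.Ioi 0) := by
  obtain ⟨C, h⟩ := wm_bound hc hs hn y ha
  refine (wm_expint (b := ω.re / 2) (by linarith) C).mono'
    (Measurable.aestronglyMeasurable (by fun_prop)) ?_
  exact (ae_restrict_iff' measurableSet_Ioi).2 (Filter.Eventually.of_forall fun t ht =>
    h t (le_of_lt ht))


noncomputable def wmI (ω : ℂ) (z a : ℝ) : ℂ :=
  ∫ ρ in Set.Ioi (0:ℝ), Complex.exp ((a:ℂ) + ρ * ω) * ((a:ℂ) + ρ * ω) ^ ((-z : ℝ):ℂ) * ω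


/-- derivative of `e^u u^{-z}` -/
lemma wm_du (z : ℝ) {u : ℂ} (hu : u ∈ Complex.slitPlane) :
    HasDerivAt (fun u : ℂ => Complex.exp u * u ^ ((-z : ℝ):ℂ))
      (Complex.exp u * u ^ ((-z : ℝ):ℂ) - z * (Complex.exp u * u ^ ((-(z + 1) : ℝ):ℂ))) u := by
  have h := (Complex.hasDerivAt_exp u).mul ((hasDerivAt_id u).cpow_const (c := ((-z : ℝ):ℂ)) hu)
  refine h.congr_deriv ?_
  have : ((-(z + 1) : ℝ):ℂ) = ((-z : ℝ):ℂ) - 1 := by push_cast; ring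
  rw [this]; push_cast; simp only [id]; ring

lemma wm_parts {ω : ℂ} (hc : ω.re < 0) (hs : 0 < ω.im) (hn : ‖ω‖ = 1) (z : ℝ) {a : ℝ} (ha : 0 < a) :
    wmI ω z a - z * wmI ω (z + 1) a = -((Real.exp a * a ^ (-z) : ℝ) : ℂ) := by
  have i1 := (wm_integrable hc hs hn (-z) ha).mul_const ω
  have i2 := ((wm_integrable hc hs hn (-(z + 1)) ha).mul_const ω).const_mul (z:ℂ)
  unfold wmI
  rw [← integral_const_mul, ← integral_sub i1 i2]
  have key := integral_Ioi_of_hasDerivAt_of_tendsto' (a := 0) (m := 0)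
    (f := fun ρ : ℝ => Complex.exp ((a:ℂ) + ρ * ω) * ((a:ℂ) + ρ * ω) ^ ((-z : ℝ):ℂ))
    (f' := fun ρ : ℝ => Complex.exp ((a:ℂ) + ρ * ω) * ((a:ℂ) + ρ * ω) ^ ((-z : ℝ):ℂ) * ω -
      z * (Complex.exp ((a:ℂ) + ρ * ω) * ((a:ℂ) + ρ * ω) ^ ((-(z + 1) : ℝ):ℂ) * ω)) ?_ (i1.sub i2) ?_
  · rw [key]
    have : (a:ℂ) ^ ((-z : ℝ):ℂ) = ((a ^ (-z) : ℝ) : ℂ) := by rw [Complex.ofReal_cpow ha.le]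
    simp only [Complex.ofReal_zero, zero_mul, add_zero, this]
    push_cast; ring
  · intro ρ hρ
    have h1 : HasDerivAt (fun ρ : ℝ => (a:ℂ) + ρ * ω) ω ρ := by
      have := ((hasDerivAt_id ρ).ofReal_comp.mul_const ω).const_add (a:ℂ)
      simpa using this
    have h2 := (wm_du z (wm_slit hs ha hρ)).comp ρ h1
    refine h2.congr_deriv ?_
    ring
  · obtain ⟨C, h⟩ := wm_bound hc hs hn (-z) ha
    refine squeeze_zero_norm' (a := fun ρ => C * Real.exp (ω.re / 2 * ρ)) ?_ ?_
    · filter_upwards [Filter.eventually_ge_atTop 0] with ρ hρ using h ρ hρ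
    · have : Filter.Tendsto (fun ρ : ℝ => Real.exp (ω.re / 2 * ρ)) Filter.atTop (nhds 0) :=
        Real.tendsto_exp_atBot.comp (Filter.tendsto_id.const_mul_atTop_of_neg (by linarith))
      simpa using this.const_mul C



lemma wm_deriv {ω : ℂ} (hc : ω.re < 0) (hs : 0 < ω.im) (hn : ‖ω‖ = 1) {z : ℝ} (hz : 0 < z) {a : ℝ} (ha : 0 < a) :
    HasDerivAt (fun a => wmI ω z a) (-((Real.exp a * a ^ (-z) : ℝ) : ℂ)) a := by
  have i1 := (wm_integrable hc hs hn (-z) ha).mul_const ω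
  have i2 := ((wm_integrable hc hs hn (-(z + 1)) ha).mul_const ω).const_mul (z:ℂ)
  rw [← wm_parts hc hs hn z ha]
  have e : wmI ω z a - z * wmI ω (z + 1) a = ∫ ρ in Set.Ioi (0:ℝ),
      (Complex.exp ((a:ℂ) + ρ * ω) * ((a:ℂ) + ρ * ω) ^ ((-z : ℝ):ℂ) -
      z * (Complex.exp ((a:ℂ) + ρ * ω) * ((a:ℂ) + ρ * ω) ^ ((-(z + 1) : ℝ):ℂ))) * ω := by
    unfold wmI
    rw [← integral_const_mul, ← integral_sub i1 i2]
    congr 1; ext ρ; ring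
  rw [e]
  refine (hasDerivAt_integral_of_dominated_loc_of_deriv_le
    (F' := fun (a:ℝ) (ρ:ℝ) => (Complex.exp ((a:ℂ) + ρ * ω) * ((a:ℂ) + ρ * ω) ^ ((-z : ℝ):ℂ) -
      z * (Complex.exp ((a:ℂ) + ρ * ω) * ((a:ℂ) + ρ * ω) ^ ((-(z + 1) : ℝ):ℂ))) * ω)
    (bound := fun ρ => Real.exp (2 * a) * ((a / 2 * ω.im) ^ (-z) + z * (a / 2 * ω.im) ^ (-(z + 1)))
      * Real.exp (ω.re * ρ))
    (s := Set.Ioo (a / 2) (2 * a)) (Ioo_mem_nhds (by linarith) (by linarith))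
    ?_ i1 ?_ ?_ ?_ ?_).2
  · exact Filter.Eventually.of_forall fun x => Measurable.aestronglyMeasurable (by fun_prop)
  · exact Measurable.aestronglyMeasurable (by fun_prop)
  · refine (ae_restrict_iff' measurableSet_Ioi).2 (Filter.Eventually.of_forall fun ρ hρ x hx => ?_)
    have hρ : (0:ℝ) < ρ := hρ
    rw [norm_mul, hn, mul_one]
    have h0 : a / 2 * ω.im ≤ ‖(x:ℂ) + ρ * ω‖ :=
      le_trans (by nlinarith [hx.1]) (wm_gea hn (a := x) (ρ := ρ))
    have hpos : 0 < a / 2 * ω.im := by positivity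
    have h1 := Real.rpow_le_rpow_of_nonpos hpos h0 (z := -z) (by linarith)
    have h2 := Real.rpow_le_rpow_of_nonpos hpos h0 (z := -(z + 1)) (by linarith)
    have h3 : Real.exp x ≤ Real.exp (2 * a) := Real.exp_le_exp.2 hx.2.le
    refine (norm_sub_le _ _).trans ?_
    rw [norm_mul, norm_mul, norm_mul, wm_exp, Complex.norm_cpow_real, Complex.norm_cpow_real,
      Complex.norm_real, Real.norm_of_nonneg hz.le]
    calc _ = Real.exp x * (‖(x:ℂ) + ρ * ω‖ ^ (-z) + z * ‖(x:ℂ) + ρ * ω‖ ^ (-(z + 1)))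
          * Real.exp (ω.re * ρ) := by ring
      _ ≤ _ := by gcongr
  · exact wm_expint hc _
  · refine (ae_restrict_iff' measurableSet_Ioi).2 (Filter.Eventually.of_forall fun ρ hρ x hx => ?_)
    have hx0 : 0 < x := by linarith [hx.1]
    have h1 : HasDerivAt (fun x : ℝ => (x:ℂ) + ρ * ω) 1 x := by
      have := ((hasDerivAt_id x).ofReal_comp).add_const (ρ * ω)
      simpa using this
    have h2 := ((wm_du z (wm_slit hs hx0 (le_of_lt hρ))).comp x h1).mul_const ω
    refine h2.congr_deriv ?_
    ring

lemma wm_cont0 {ω : ℂ} (hc : ω.re < 0) (hs : 0 < ω.im) (hn : ‖ω‖ = 1) {z : ℝ} (hz : 0 < z) (hz1 : z < 1) :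
    ContinuousWithinAt (fun a => wmI ω z a) (Set.Icc 0 1) 0 := by
  refine continuousWithinAt_of_dominated
    (bound := fun ρ => Real.exp 1 * ω.im ^ (-z) * (ρ ^ ((1 - z) - 1) * Real.exp (-((-ω.re) * ρ))))
    ?_ ?_ ?_ ?_
  · exact Filter.Eventually.of_forall fun x => Measurable.aestronglyMeasurable (by fun_prop)
  · filter_upwards [self_mem_nhdsWithin] with a ha
    refine (ae_restrict_iff' measurableSet_Ioi).2 (Filter.Eventually.of_forall fun ρ hρ => ?_)
    have hρ : (0:ℝ) < ρ := hρ
    rw [norm_mul, hn, mul_one, norm_mul, wm_exp, Complex.norm_cpow_real]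
    have h1 := Real.rpow_le_rpow_of_nonpos (by positivity) (wm_geρ ω (a := a) (ρ := ρ))
      (z := -z) (by linarith)
    rw [Real.mul_rpow hρ.le hs.le] at h1
    have h3 : Real.exp a ≤ Real.exp 1 := Real.exp_le_exp.2 ha.2
    have e1 : (1 - z) - 1 = -z := by ring
    have e2 : -((-ω.re) * ρ) = ω.re * ρ := by ring
    rw [e1, e2]
    calc _ ≤ Real.exp 1 * Real.exp (ω.re * ρ) * (ρ ^ (-z) * ω.im ^ (-z)) := by gcongr
      _ = _ := by ring
  · exact (wm_int (1 - z) (-ω.re) (by linarith) (by linarith)).const_mul _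
  · refine (ae_restrict_iff' measurableSet_Ioi).2 (Filter.Eventually.of_forall fun ρ hρ => ?_)
    have hρ : (0:ℝ) < ρ := hρ
    apply ContinuousAt.continuousWithinAt
    have hsl : ((0:ℝ):ℂ) + ρ * ω ∈ Complex.slitPlane := by
      right; simp; exact ⟨hρ.ne', hs.ne'⟩
    have h1 : ContinuousAt (fun x : ℝ => (x:ℂ) + ρ * ω) 0 := by fun_prop
    have h2 : ContinuousAt (fun u : ℂ => Complex.exp u * u ^ ((-z : ℝ):ℂ) * ω)
        (((0:ℝ):ℂ) + ρ * ω) := (wm_du z hsl).continuousAt.mul continuousAt_const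
    exact ContinuousAt.comp (f := fun x : ℝ => (x:ℂ) + ρ * ω) h2 h1

lemma wm_im_eq {ω : ℂ} (hc : ω.re < 0) (hs : 0 < ω.im) (hn : ‖ω‖ = 1) {z : ℝ} (hz : 0 < z) (hz1 : z < 1) : (wmI ω z 1).im = (wmI ω z 0).im := by
  have key := exists_hasDerivAt_eq_slope (fun a => (wmI ω z a).im) (fun _ => 0)
    (a := 0) (b := 1) one_pos ?_ ?_
  · obtain ⟨c, hc1, hc2⟩ := key
    simp only [sub_zero, div_one] at hc2
    linarith
  · intro a ha
    rcases ha.1.eq_or_lt with h | h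
    · subst h
      exact Complex.continuous_im.continuousAt.comp_continuousWithinAt (wm_cont0 hc hs hn hz hz1)
    · exact (Complex.continuous_im.continuousAt.comp
        (wm_deriv hc hs hn hz h).continuousAt).continuousWithinAt
  · intro a ha
    have h1 := wm_deriv hc hs hn hz ha.1
    have h2 := Complex.imCLM.hasFDerivAt.comp_hasDerivAt a h1
    refine h2.congr_deriv ?_
    simp only [Complex.imCLM_apply, Complex.neg_im, Complex.ofReal_im, neg_zero]

lemma wm_contz {ω : ℂ} (hc : ω.re < 0) (hs : 0 < ω.im) (hn : ‖ω‖ = 1) : ContinuousAt (fun z => (wmI ω z 1).im) 1 := by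
  refine Complex.continuous_im.continuousAt.comp ?_
  refine continuousAt_of_dominated
    (bound := fun ρ => (Real.exp 1 * ω.im ^ (-(2:ℝ))) * Real.exp (ω.re * ρ)) ?_ ?_ ?_ ?_
  · exact Filter.Eventually.of_forall fun x => Measurable.aestronglyMeasurable (by fun_prop)
  · filter_upwards [Ioo_mem_nhds (a := 0) (b := (2:ℝ)) one_pos one_lt_two] with z hz
    refine (ae_restrict_iff' measurableSet_Ioi).2 (Filter.Eventually.of_forall fun ρ hρ => ?_)
    rw [norm_mul, hn, mul_one, norm_mul, wm_exp, Complex.norm_cpow_real]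
    have h0 := wm_gea hn (a := 1) (ρ := ρ)
    rw [one_mul] at h0
    have h1 := Real.rpow_le_rpow_of_nonpos hs h0 (z := -z) (by linarith [hz.1])
    have him : ω.im ≤ 1 := hn ▸ (le_abs_self _).trans (Complex.abs_im_le_norm ω)
    have h2 : ω.im ^ (-z) ≤ ω.im ^ (-(2:ℝ)) :=
      Real.rpow_le_rpow_of_exponent_ge hs him (by linarith [hz.2])
    calc _ ≤ Real.exp 1 * Real.exp (ω.re * ρ) * ω.im ^ (-(2:ℝ)) := by
          gcongr; exact h1.trans h2
      _ = _ := by ring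
  · exact wm_expint hc _
  · refine (ae_restrict_iff' measurableSet_Ioi).2 (Filter.Eventually.of_forall fun ρ hρ => ?_)
    have h := Complex.slitPlane_ne_zero (wm_slit hs one_pos (le_of_lt hρ) : ((1:ℝ):ℂ) + ρ * ω ∈ _)
    have h1 : ContinuousAt (fun x : ℝ => ((-x : ℝ) : ℂ)) 1 := by fun_prop
    have h2 : ContinuousAt (fun x : ℝ => (((1:ℝ):ℂ) + ρ * ω) ^ ((-x : ℝ) : ℂ)) 1 :=
      h1.const_cpow (Or.inl h)
    exact (continuousAt_const.mul h2).mul continuousAt_const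


lemma wm_val0 {φ : ℝ} (h1 : Real.pi / 2 < φ) (h2 : φ < Real.pi) {z : ℝ} (hz : 0 < z) (hz1 : z < 1) :
    (wmI (Complex.exp (φ * Complex.I)) z 0).im = Real.sin (Real.pi * z) * Real.Gamma (1 - z) := by
  have hpi := Real.pi_pos
  set ω := Complex.exp (φ * Complex.I) with hω
  set w := Complex.exp (((φ - Real.pi : ℝ) : ℂ) * Complex.I) with hw
  have hwω : w = -ω := by
    rw [hw, hω]; push_cast
    rw [sub_mul, Complex.exp_sub, Complex.exp_pi_mul_I, div_neg, div_one]
  have hwre : 0 < w.re := by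
    rw [hw, Complex.exp_ofReal_mul_I_re]
    exact Real.cos_pos_of_mem_Ioo ⟨by linarith, by linarith⟩
  have lω : Complex.log ω = φ * Complex.I := by
    rw [hω, Complex.log_exp] <;> rw [Complex.im_ofReal_mul, Complex.I_im] <;> linarith
  have lw : Complex.log w = ((φ - Real.pi : ℝ) : ℂ) * Complex.I := by
    rw [hw, Complex.log_exp] <;> rw [Complex.im_ofReal_mul, Complex.I_im] <;> linarith
  have key := wm_gam (1 - z) (by linarith) w hwre
  have hI : wmI ω z 0 = (∫ t in Set.Ioi (0:ℝ), ((t ^ ((1 - z) - 1) : ℝ) : ℂ) *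
      Complex.exp (-(w * t))) * (ω ^ ((-z : ℝ):ℂ) * ω) := by
    unfold wmI
    rw [← integral_mul_const]
    refine setIntegral_congr_fun measurableSet_Ioi fun t ht => ?_
    have ht : (0:ℝ) < t := ht
    have hω0 : ω ≠ 0 := Complex.exp_ne_zero _
    have e1 : ((t:ℂ) * ω) ^ ((-z : ℝ):ℂ) = ((t ^ (-z) : ℝ) : ℂ) * ω ^ ((-z : ℝ):ℂ) := by
      rw [Complex.cpow_def_of_ne_zero (mul_ne_zero (by exact_mod_cast ht.ne') hω0),
        Complex.log_ofReal_mul ht hω0, Complex.cpow_def_of_ne_zero hω0, Real.rpow_def_of_pos ht,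
        Complex.ofReal_exp, ← Complex.exp_add]
      congr 1; push_cast; ring
    have e2 : (1 - z) - 1 = -z := by ring
    simp only [Complex.ofReal_zero, zero_add, e1, e2, hwω]
    rw [show -(-ω * (t:ℂ)) = t * ω by ring]
    ring
  have e : w ^ (-((1 - z : ℝ):ℂ)) * (ω ^ ((-z : ℝ):ℂ) * ω) =
      Complex.exp (((Real.pi - Real.pi * z : ℝ) : ℂ) * Complex.I) := by
    rw [Complex.cpow_def_of_ne_zero (Complex.exp_ne_zero _),
      Complex.cpow_def_of_ne_zero (Complex.exp_ne_zero _), lω, lw]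
    conv_lhs => rw [hω]
    rw [← Complex.exp_add, ← Complex.exp_add]
    congr 1; push_cast; ring
  rw [hI, key]
  rw [show w ^ (-((1 - z : ℝ):ℂ)) * (Real.Gamma (1 - z) : ℂ) * (ω ^ ((-z : ℝ):ℂ) * ω) =
    (w ^ (-((1 - z : ℝ):ℂ)) * (ω ^ ((-z : ℝ):ℂ) * ω)) * (Real.Gamma (1 - z) : ℂ) by ring, e,
    Complex.im_mul_ofReal, Complex.exp_ofReal_mul_I_im, Real.sin_pi_sub]

lemma wm_rG (z : ℝ) : (Real.Gamma z)⁻¹ = z * (Real.Gamma (z + 1))⁻¹ := by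
  by_cases h : z = 0
  · subst h; simp
  · rw [Real.Gamma_add_one h]; field_simp

lemma wm_hankel {φ : ℝ} (h1 : Real.pi / 2 < φ) (h2 : φ < Real.pi) (z : ℝ) :
    (wmI (Complex.exp (φ * Complex.I)) z 1).im = Real.pi * (Real.Gamma z)⁻¹ := by
  have hpi := Real.pi_pos
  set ω := Complex.exp (φ * Complex.I) with hω
  have hn : ‖ω‖ = 1 := Complex.norm_exp_ofReal_mul_I φ
  have hc : ω.re < 0 := by
    rw [hω, Complex.exp_ofReal_mul_I_re]
    exact Real.cos_neg_of_pi_div_two_lt_of_lt h1 (by linarith)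
  have hs : 0 < ω.im := by
    rw [hω, Complex.exp_ofReal_mul_I_im]
    exact Real.sin_pos_of_pos_of_lt_pi (by linarith) h2
  have hrec : ∀ z : ℝ, (wmI ω z 1).im = z * (wmI ω (z + 1) 1).im := by
    intro z
    have := congrArg Complex.im (wm_parts hc hs hn z one_pos)
    rw [Complex.sub_im, Complex.im_ofReal_mul, Complex.neg_im, Complex.ofReal_im] at this
    linarith
  have base : ∀ z : ℝ, 0 < z → z < 1 → (wmI ω z 1).im = Real.pi * (Real.Gamma z)⁻¹ := by
    intro z hz hz1
    rw [wm_im_eq hc hs hn hz hz1, wm_val0 h1 h2 hz hz1]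
    have h := Real.Gamma_mul_Gamma_one_sub z
    have hG := (Real.Gamma_pos_of_pos hz).ne'
    have hsin : Real.sin (Real.pi * z) ≠ 0 :=
      (Real.sin_pos_of_pos_of_lt_pi (by positivity) (by nlinarith)).ne'
    rw [eq_div_iff hsin] at h
    rw [eq_mul_inv_iff_mul_eq₀ hG]
    linarith
  have hone : (wmI ω 1 1).im = Real.pi * (Real.Gamma 1)⁻¹ := by
    have t1 : Filter.Tendsto (fun z => (wmI ω z 1).im) (nhdsWithin 1 (Set.Iio 1))
        (nhds (wmI ω 1 1).im) := (wm_contz hc hs hn).tendsto.mono_left nhdsWithin_le_nhds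
    have c2 : ContinuousAt (fun z => Real.pi * (Real.Gamma z)⁻¹) 1 := by
      have : ContinuousAt Real.Gamma 1 :=
        (Real.differentiableAt_Gamma (fun m => by
          have : (0:ℝ) ≤ m := m.cast_nonneg
          linarith)).continuousAt
      exact continuousAt_const.mul (this.inv₀ (by simp))
    have t2 := c2.tendsto.mono_left (nhdsWithin_le_nhds (s := Set.Iio 1))
    refine tendsto_nhds_unique (t1.congr' ?_) t2
    filter_upwards [Ioo_mem_nhdsLT (zero_lt_one' ℝ)] with z hz using base z hz.1 hz.2
  have up : ∀ n : ℕ, ∀ z : ℝ, 0 < z → z ≤ n + 1 → (wmI ω z 1).im = Real.pi * (Real.Gamma z)⁻¹ := by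
    intro n
    induction n with
    | zero =>
      intro z hz hz1
      rcases hz1.eq_or_lt with h | h
      · simp only [Nat.cast_zero, zero_add] at h; rw [h]; exact hone
      · exact base z hz (by simpa using h)
    | succ n ih =>
      intro z hz hz1
      by_cases h : z ≤ n + 1
      · exact ih z hz h
      · have hz0 : 0 < z - 1 := by
          have : (0:ℝ) ≤ n := n.cast_nonneg
          linarith
        have h3 := ih (z - 1) hz0 (by push_cast at hz1; linarith)
        rw [hrec, wm_rG, sub_add_cancel] at h3
        apply mul_left_cancel₀ hz0.ne'
        rw [h3]; ring
  have down : ∀ n : ℕ, ∀ z : ℝ, -(n:ℝ) < z → (wmI ω z 1).im = Real.pi * (Real.Gamma z)⁻¹ := by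
    intro n
    induction n with
    | zero =>
      intro z hz
      obtain ⟨m, hm⟩ := exists_nat_ge z
      exact up m z (by simpa using hz) (by linarith)
    | succ n ih =>
      intro z hz
      rw [hrec, wm_rG, ih (z + 1) (by push_cast at hz; linarith)]; ring
  obtain ⟨m, hm⟩ := exists_nat_gt (-z)
  exact down m z (by linarith)


lemma wm_young {t γ c : ℝ} (ht : 0 < t) (h0 : 0 < γ) (h1 : γ < 1) (hc : 0 < c) :
    ∃ K : ℝ, 0 ≤ K ∧ ∀ x : ℝ, 0 < x → Real.exp (t * x ^ γ) ≤ K * Real.exp (c * x) := by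
  set X := (t / c) ^ (1 / (1 - γ)) with hX
  have hX0 : 0 < X := by positivity
  refine ⟨Real.exp (t * X ^ γ), by positivity, fun x hx => ?_⟩
  rw [← Real.exp_add]
  apply Real.exp_le_exp.2
  have p1 : 0 ≤ t * X ^ γ := by positivity
  have p2 : 0 ≤ c * x := by positivity
  rcases le_total X x with h | h
  · have h2 : X ^ (1 - γ) ≤ x ^ (1 - γ) := by gcongr
    have h3 : X ^ (1 - γ) = t / c := by
      rw [hX, ← Real.rpow_mul (by positivity), one_div_mul_cancel (by linarith), Real.rpow_one]
    rw [h3, div_le_iff₀ hc] at h2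
    have h4 : x ^ (1 - γ) * x ^ γ = x := by
      rw [← Real.rpow_add hx, sub_add_cancel, Real.rpow_one]
    have : t * x ^ γ ≤ x ^ (1 - γ) * c * x ^ γ := by gcongr
    nlinarith
  · have : t * x ^ γ ≤ t * X ^ γ := by gcongr
    linarith

lemma wm_arg {φ : ℝ} (h1 : Real.pi / 2 < φ) (h2 : φ < Real.pi) {ρ : ℝ} (hρ : 0 ≤ ρ) :
    0 ≤ (((1:ℝ):ℂ) + ρ * Complex.exp (φ * Complex.I)).arg ∧
    (((1:ℝ):ℂ) + ρ * Complex.exp (φ * Complex.I)).arg ≤ φ := by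
  have hpi := Real.pi_pos
  have hc : Real.cos φ < 0 := Real.cos_neg_of_pi_div_two_lt_of_lt h1 (by linarith)
  have hs : 0 < Real.sin φ := Real.sin_pos_of_pos_of_lt_pi (by linarith) h2
  set u := ((1:ℝ):ℂ) + ρ * Complex.exp (φ * Complex.I) with hu
  have hre : u.re = 1 + ρ * Real.cos φ := by
    rw [hu, Complex.add_re, Complex.re_ofReal_mul, Complex.exp_ofReal_mul_I_re, Complex.ofReal_re]
  have him : u.im = ρ * Real.sin φ := by
    rw [hu, Complex.add_im, Complex.im_ofReal_mul, Complex.exp_ofReal_mul_I_im, Complex.ofReal_im,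
      zero_add]
  have him0 : 0 ≤ u.im := by rw [him]; positivity
  have hu0 : u ≠ 0 := Complex.slitPlane_ne_zero (wm_slit
    (by rw [Complex.exp_ofReal_mul_I_im]; exact hs) one_pos hρ)
  refine ⟨Complex.arg_nonneg_iff.2 him0, ?_⟩
  have hnp : 0 < ‖u‖ := norm_pos_iff.2 hu0
  rw [Complex.arg_of_im_nonneg_of_ne_zero him0 hu0]
  have e : Real.arccos (Real.cos φ) = φ := Real.arccos_cos (by linarith) h2.le
  rw [← e]
  apply Real.arccos_le_arccos
  rw [le_div_iff₀ hnp]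
  by_cases hp : 0 ≤ u.re
  · nlinarith
  · push Not at hp
    have hsq : ‖u‖ ^ 2 = u.re ^ 2 + u.im ^ 2 := by
      rw [← Complex.normSq_eq_norm_sq, Complex.normSq_apply]; ring
    have : (-u.re) ^ 2 ≤ (-(Real.cos φ * ‖u‖)) ^ 2 := by
      rw [neg_sq, neg_sq, mul_pow, hsq]
      have hsc := Real.sin_sq_add_cos_sq φ
      have e1 : Real.sin φ ^ 2 = 1 - Real.cos φ ^ 2 := by linarith
      have e2 : (0:ℝ) < 1 - Real.cos φ ^ 2 := by rw [← e1]; positivity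
      rw [hre] at hp
      rw [hre, him, mul_pow ρ (Real.sin φ), e1]
      nlinarith
    have := sq_le_sq.1 this
    rw [abs_of_nonneg (by linarith), abs_of_nonneg (by nlinarith)] at this
    linarith

lemma wm_re {φ γ : ℝ} (h1 : Real.pi / 2 < φ) (h2 : φ < Real.pi) (hγ : 0 < γ)
    (h3 : γ * φ < Real.pi / 2) {ρ : ℝ} (hρ : 0 ≤ ρ) :
    (Complex.exp (φ * Complex.I)).im ^ γ * Real.cos (γ * φ) ≤
    ((((1:ℝ):ℂ) + ρ * Complex.exp (φ * Complex.I)) ^ (γ:ℂ)).re := by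
  have hpi := Real.pi_pos
  obtain ⟨a0, a1⟩ := wm_arg h1 h2 hρ
  rw [Complex.cpow_ofReal_re]
  have hs : 0 < Real.sin φ := Real.sin_pos_of_pos_of_lt_pi (by linarith) h2
  have hg := wm_gea (Complex.norm_exp_ofReal_mul_I φ) (a := 1) (ρ := ρ)
  rw [one_mul] at hg
  have hs' : 0 ≤ (Complex.exp (φ * Complex.I)).im := by
    rw [Complex.exp_ofReal_mul_I_im]; exact hs.le
  have hcp : 0 < Real.cos (γ * φ) :=
    Real.cos_pos_of_mem_Ioo ⟨by nlinarith, h3⟩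
  have hcc : Real.cos (γ * φ) ≤
      Real.cos ((((1:ℝ):ℂ) + ρ * Complex.exp (φ * Complex.I)).arg * γ) := by
    apply Real.cos_le_cos_of_nonneg_of_le_pi
    · positivity
    · linarith
    · nlinarith
  gcongr

lemma wm_rep {φ γ t : ℝ} (h1 : Real.pi / 2 < φ) (h2 : φ < Real.pi) (hγ : 0 < γ) (hγ1 : γ < 1)
    (ht : 0 < t) :
    wright γ t = Real.pi⁻¹ * (∫ ρ in Set.Ioi (0:ℝ),
      (Complex.exp (((1:ℝ):ℂ) + ρ * Complex.exp (φ * Complex.I)) *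
      (((1:ℝ):ℂ) + ρ * Complex.exp (φ * Complex.I)) ^ ((γ - 1 : ℝ):ℂ) *
        Complex.exp (φ * Complex.I)) *
      Complex.exp (-((((1:ℝ):ℂ) + ρ * Complex.exp (φ * Complex.I)) ^ (γ:ℂ) * t))).im := by
  have hpi := Real.pi_pos
  have hank := fun z => wm_hankel h1 h2 z
  set ω := Complex.exp (φ * Complex.I) with hω
  have hn : ‖ω‖ = 1 := Complex.norm_exp_ofReal_mul_I φ
  have hc : ω.re < 0 := by
    rw [hω, Complex.exp_ofReal_mul_I_re]
    exact Real.cos_neg_of_pi_div_two_lt_of_lt h1 (by linarith)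
  have hs : 0 < ω.im := by
    rw [hω, Complex.exp_ofReal_mul_I_im]
    exact Real.sin_pos_of_pos_of_lt_pi (by linarith) h2
  have hsumC : ∀ x : ℂ, HasSum (fun n : ℕ => x ^ n / n.factorial) (Complex.exp x) := by
    intro x
    rw [Complex.exp_eq_exp_ℂ]; exact NormedSpace.expSeries_div_hasSum_exp x
  have hsumR : ∀ x : ℝ, HasSum (fun n : ℕ => x ^ n / n.factorial) (Real.exp x) := by
    intro x
    rw [Real.exp_eq_exp_ℝ]; exact NormedSpace.expSeries_div_hasSum_exp x
  have hS := hasSum_integral_of_dominated_convergence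
    (μ := volume.restrict (Set.Ioi (0:ℝ)))
    (F := fun (n : ℕ) (ρ : ℝ) => (Complex.exp (((1:ℝ):ℂ) + ρ * ω) *
      (((1:ℝ):ℂ) + ρ * ω) ^ ((γ - 1 : ℝ):ℂ) * ω) *
      ((-((((1:ℝ):ℂ) + ρ * ω) ^ (γ:ℂ) * t)) ^ n / n.factorial))
    (f := fun (ρ : ℝ) => (Complex.exp (((1:ℝ):ℂ) + ρ * ω) *
      (((1:ℝ):ℂ) + ρ * ω) ^ ((γ - 1 : ℝ):ℂ) * ω) *
      Complex.exp (-((((1:ℝ):ℂ) + ρ * ω) ^ (γ:ℂ) * t)))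
    (fun (n : ℕ) (ρ : ℝ) => ‖Complex.exp (((1:ℝ):ℂ) + ρ * ω) *
      (((1:ℝ):ℂ) + ρ * ω) ^ ((γ - 1 : ℝ):ℂ)‖ *
      ((t * ‖((1:ℝ):ℂ) + ρ * ω‖ ^ γ) ^ n / n.factorial))
    ?_ ?_ ?_ ?_ ?_
  · have hI : ∀ n : ℕ, (∫ ρ in Set.Ioi (0:ℝ), (Complex.exp (((1:ℝ):ℂ) + ρ * ω) *
      (((1:ℝ):ℂ) + ρ * ω) ^ ((γ - 1 : ℝ):ℂ) * ω) *
      ((-((((1:ℝ):ℂ) + ρ * ω) ^ (γ:ℂ) * t)) ^ n / n.factorial)) =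
      (((-t) ^ n / n.factorial : ℝ) : ℂ) * wmI ω (1 - γ - γ * n) 1 := by
      intro n
      unfold wmI
      rw [← integral_const_mul]
      refine setIntegral_congr_fun measurableSet_Ioi fun ρ hρ => ?_
      have h0 := Complex.slitPlane_ne_zero
        (wm_slit hs one_pos (le_of_lt hρ) : ((1:ℝ):ℂ) + ρ * ω ∈ _)
      have e : (((1:ℝ):ℂ) + ρ * ω) ^ ((-(1 - γ - γ * n) : ℝ):ℂ) =
          (((1:ℝ):ℂ) + ρ * ω) ^ ((γ - 1 : ℝ):ℂ) * ((((1:ℝ):ℂ) + ρ * ω) ^ (γ:ℂ)) ^ n := by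
        rw [← Complex.cpow_nat_mul, ← Complex.cpow_add _ _ h0]
        congr 1; push_cast; ring
      simp only [e]
      push_cast
      rw [show ∀ x : ℂ, -(x * t) = (-t : ℂ) * x by intro x; ring, mul_pow]
      ring
    simp_rw [hI] at hS
    have hS2 := Complex.imCLM.hasSum hS
    simp only [Complex.imCLM_apply, Complex.im_ofReal_mul, hank] at hS2
    have hS3 := hS2.mul_left Real.pi⁻¹
    rw [← hS3.tsum_eq]
    unfold wright
    congr 1; ext n
    field_simp
  · exact fun n => Measurable.aestronglyMeasurable (by fun_prop)
  · intro n
    refine Filter.Eventually.of_forall fun ρ => le_of_eq ?_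
    rw [norm_mul, norm_mul _ ω, hn, mul_one, norm_div, norm_pow, norm_neg,
      norm_mul (_ ^ _) (t:ℂ), Complex.norm_cpow_real _ γ, Complex.norm_real, Real.norm_of_nonneg ht.le, Complex.norm_natCast,
      mul_comm t]
  · exact Filter.Eventually.of_forall fun ρ => ((hsumR _).mul_left _).summable
  · simp_rw [fun ρ : ℝ => ((hsumR (t * ‖((1:ℝ):ℂ) + ρ * ω‖ ^ γ)).mul_left
      ‖Complex.exp (((1:ℝ):ℂ) + ρ * ω) * (((1:ℝ):ℂ) + ρ * ω) ^ ((γ - 1 : ℝ):ℂ)‖).tsum_eq]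
    obtain ⟨C, hC⟩ := wm_bound hc hs hn (γ - 1) one_pos
    obtain ⟨K, hK0, hK⟩ := wm_young ht hγ hγ1 (c := -ω.re / 4) (by linarith)
    refine (wm_expint (b := ω.re / 4) (by linarith) (C * K * Real.exp (-ω.re / 4))).mono'
      (Measurable.aestronglyMeasurable (by fun_prop)) ?_
    refine (ae_restrict_iff' measurableSet_Ioi).2 (Filter.Eventually.of_forall fun ρ hρ => ?_)
    have hρ : (0:ℝ) < ρ := hρ
    rw [Real.norm_of_nonneg (by positivity)]
    have h0 := Complex.slitPlane_ne_zero
        (wm_slit hs one_pos hρ.le : ((1:ℝ):ℂ) + ρ * ω ∈ _)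
    have b1 := hC ρ hρ.le
    have b2 := hK _ (norm_pos_iff.2 h0)
    have b3 : Real.exp (-ω.re / 4 * ‖((1:ℝ):ℂ) + ρ * ω‖) ≤ Real.exp (-ω.re / 4 * (1 + ρ)) := by
      have := wm_le hn zero_le_one hρ.le
      apply Real.exp_le_exp.2
      nlinarith
    calc _ ≤ (C * Real.exp (ω.re / 2 * ρ)) * (K * Real.exp (-ω.re / 4 * (1 + ρ))) := by
          refine mul_le_mul b1 (b2.trans (by gcongr)) (by positivity) ((norm_nonneg _).trans b1)
      _ = C * K * (Real.exp (ω.re / 2 * ρ) * Real.exp (-ω.re / 4 * (1 + ρ))) := by ring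
      _ = C * K * (Real.exp (-ω.re / 4) * Real.exp (ω.re / 4 * ρ)) := by
          rw [← Real.exp_add, ← Real.exp_add]; congr 2; ring
      _ = _ := by ring
  · exact Filter.Eventually.of_forall fun ρ => (hsumC _).mul_left _

/-- For `γ ∈ (0,1)` and every `r > -1`, `∫_0^∞ t^r Φ_γ(t) dt = Γ(1+r)/Γ(1+γr)`. -/
theorem wright_moments (γ : ℝ) (hγ : γ ∈ Set.Ioo (0:ℝ) 1) (r : ℝ) (hr : -1 < r) :
    ∫ t in Set.Ioi (0:ℝ), t ^ r * wright γ t = Real.Gamma (1 + r) / Real.Gamma (1 + γ * r) := by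
  obtain ⟨hγ0, hγ1⟩ := hγ
  have hpi := Real.pi_pos
  obtain ⟨φ, h1, h2, h3⟩ : ∃ φ : ℝ, Real.pi / 2 < φ ∧ φ < Real.pi ∧ γ * φ < Real.pi / 2 := by
    refine ⟨Real.pi / (1 + γ), ?_, ?_, ?_⟩
    · rw [div_lt_div_iff₀ (by norm_num) (by linarith)]; nlinarith
    · rw [div_lt_iff₀ (by linarith)]; nlinarith
    · rw [← mul_div_assoc, div_lt_div_iff₀ (by linarith) (by norm_num)]; nlinarith
  have hrep : ∀ t : ℝ, 0 < t → _ := fun t ht => wm_rep h1 h2 hγ0 hγ1 ht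
  have hank := wm_hankel h1 h2 (1 + γ * r)
  have hre := fun ρ hρ => wm_re h1 h2 hγ0 h3 (ρ := ρ) hρ
  have harg := fun ρ hρ => wm_arg h1 h2 (ρ := ρ) hρ
  set ω := Complex.exp (φ * Complex.I) with hω
  have hn : ‖ω‖ = 1 := Complex.norm_exp_ofReal_mul_I φ
  have hc : ω.re < 0 := by
    rw [hω, Complex.exp_ofReal_mul_I_re]
    exact Real.cos_neg_of_pi_div_two_lt_of_lt h1 (by linarith)
  have hs : 0 < ω.im := by
    rw [hω, Complex.exp_ofReal_mul_I_im]
    exact Real.sin_pos_of_pos_of_lt_pi (by linarith) h2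
  set δ := ω.im ^ γ * Real.cos (γ * φ) with hδ
  have hδ0 : 0 < δ := by
    have : 0 < Real.cos (γ * φ) := Real.cos_pos_of_mem_Ioo ⟨by nlinarith, h3⟩
    positivity
  set g : ℝ → ℂ := fun ρ => Complex.exp (((1:ℝ):ℂ) + ρ * ω) *
      (((1:ℝ):ℂ) + ρ * ω) ^ ((γ - 1 : ℝ):ℂ) * ω with hg
  have hgi : IntegrableOn g (Set.Ioi 0) := (wm_integrable hc hs hn (γ - 1) one_pos).mul_const ω
  set f : ℝ → ℝ → ℂ := fun t ρ => ((t ^ ((1 + r) - 1) : ℝ) : ℂ) *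
    (g ρ * Complex.exp (-((((1:ℝ):ℂ) + ρ * ω) ^ (γ:ℂ) * t))) with hf
  have hfi : Integrable (Function.uncurry f)
      ((volume.restrict (Set.Ioi (0:ℝ))).prod (volume.restrict (Set.Ioi (0:ℝ)))) := by
    have hb := (wm_int (1 + r) δ (by linarith) hδ0).integrable.mul_prod hgi.norm
    refine hb.mono' (Measurable.aestronglyMeasurable ?_) ?_
    · simp only [hf, hg, Function.uncurry_def]; fun_prop
    · rw [Measure.prod_restrict]
      refine (ae_restrict_iff' (measurableSet_Ioi.prod measurableSet_Ioi)).2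
        (Filter.Eventually.of_forall fun p hp => ?_)
      have hp1 : 0 < p.1 := hp.1
      have hp2 : 0 < p.2 := hp.2
      simp only [Function.uncurry_def, hf]
      rw [norm_mul, norm_mul, Complex.norm_real, Real.norm_of_nonneg (by positivity),
        Complex.norm_exp, Complex.neg_re, Complex.re_mul_ofReal]
      have : Real.exp (-(((((1:ℝ):ℂ) + p.2 * ω) ^ (γ:ℂ)).re * p.1)) ≤ Real.exp (-(δ * p.1)) := by
        apply Real.exp_le_exp.2
        have := hre p.2 hp2.le
        nlinarith
      calc _ ≤ p.1 ^ (1 + r - 1) * (‖g p.2‖ * Real.exp (-(δ * p.1))) := by gcongr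
        _ = _ := by ring
  have step1 : ∫ t in Set.Ioi (0:ℝ), t ^ r * wright γ t =
      Real.pi⁻¹ * (∫ t in Set.Ioi (0:ℝ), ∫ ρ in Set.Ioi (0:ℝ), f t ρ).im := by
    have := Complex.imCLM.integral_comp_comm hfi.integral_prod_left
    simp only [Complex.imCLM_apply, Function.uncurry_apply_pair] at this
    rw [← this, ← integral_const_mul]
    refine setIntegral_congr_fun measurableSet_Ioi fun t ht => ?_
    simp only [hf]
    rw [integral_const_mul, Complex.im_ofReal_mul, hrep t ht, add_sub_cancel_left]
    ring
  have step2 : (∫ t in Set.Ioi (0:ℝ), ∫ ρ in Set.Ioi (0:ℝ), f t ρ) =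
      (Real.Gamma (1 + r) : ℂ) * wmI ω (1 + γ * r) 1 := by
    rw [integral_integral_swap hfi]
    unfold wmI
    rw [← integral_const_mul]
    refine setIntegral_congr_fun measurableSet_Ioi fun ρ hρ => ?_
    have hρ : (0:ℝ) < ρ := hρ
    have h0 := Complex.slitPlane_ne_zero (wm_slit hs one_pos hρ.le : ((1:ℝ):ℂ) + ρ * ω ∈ _)
    have hk := wm_gam (1 + r) (by linarith) ((((1:ℝ):ℂ) + ρ * ω) ^ (γ:ℂ))
      (lt_of_lt_of_le hδ0 (hre ρ hρ.le))
    have e1 : ∫ t in Set.Ioi (0:ℝ), f t ρ = g ρ * ∫ t in Set.Ioi (0:ℝ),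
        ((t ^ ((1 + r) - 1) : ℝ) : ℂ) *
          Complex.exp (-((((1:ℝ):ℂ) + ρ * ω) ^ (γ:ℂ) * t)) := by
      rw [← integral_const_mul]
      congr 1; ext t; simp only [hf]; ring
    simp only [e1, hk]
    obtain ⟨a0, a1⟩ := harg ρ hρ.le
    have him : (Complex.log (((1:ℝ):ℂ) + ρ * ω) * (γ:ℂ)).im = (((1:ℝ):ℂ) + ρ * ω).arg * γ := by
      rw [Complex.im_mul_ofReal, Complex.log_im]
    have e2 : (((1:ℝ):ℂ) + ρ * ω) ^ ((-(1 + γ * r) : ℝ):ℂ) =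
        (((1:ℝ):ℂ) + ρ * ω) ^ ((γ - 1 : ℝ):ℂ) *
          ((((1:ℝ):ℂ) + ρ * ω) ^ (γ:ℂ)) ^ (-((1 + r : ℝ):ℂ)) := by
      rw [← Complex.cpow_mul _ (by rw [him]; nlinarith) (by rw [him]; nlinarith),
        ← Complex.cpow_add _ _ h0]
      congr 1; push_cast; ring
    rw [e2]
    simp only [hg]
    ring
  rw [step1, step2, Complex.im_ofReal_mul, hank]
  field_simp
end

section
/- Let γ ∈ (0,1). The Wright function Φ_γ satisfies ∫_0^∞ e^{−zt} Φ_γ(t) dt = E_γ(−z) for all z ∈ ℂ, where E_γ is the Mittag-Leffler function E_γ(w) = Σ_{n=0}^∞ w^n / Γ(1 + γn). -/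
open MeasureTheory

open Filter Topology in
lemma wl_decay {κ a b : ℝ} (hκ : 0 < κ) (ha : 1 < a) (hb : 0 ≤ b) (hba : b < a) (M K p : ℝ) (hp : 0 ≤ p) :
    ∃ C : ℝ, ∀ r : ℝ, 0 ≤ r →
      Real.exp (-κ * r ^ a + M * r ^ (a - 1) + K * r ^ b) * r ^ p ≤ C * (1 + r ^ 2)⁻¹ := by
  set g : ℝ → ℝ := fun r =>
    Real.exp (-κ * r ^ a + M * r ^ (a - 1) + K * r ^ b + r) * (Real.exp (-r) * r ^ p + Real.exp (-r) * r ^ (p + 2)) with hg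
  have hexpo : Tendsto (fun r : ℝ => -κ * r ^ a + M * r ^ (a - 1) + K * r ^ b + r) atTop atBot := by
    have h1 : Tendsto (fun r : ℝ => -κ + M * r ^ (-(1:ℝ)) + K * r ^ (-(a - b)) + r ^ (-(a - 1))) atTop
        (𝓝 (-κ + M * 0 + K * 0 + 0)) := by
      have e1 := tendsto_rpow_neg_atTop (y := 1) one_pos
      have e2 := tendsto_rpow_neg_atTop (y := a - b) (by linarith)
      have e3 := tendsto_rpow_neg_atTop (y := a - 1) (by linarith)
      exact ((tendsto_const_nhds.add (e1.const_mul M)).add (e2.const_mul K)).add e3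
    have h2 := (tendsto_rpow_atTop (y := a) (by linarith)).atTop_mul_neg (C := -κ + M * 0 + K * 0 + 0) (by linarith) h1
    refine h2.congr' ?_
    filter_upwards [eventually_gt_atTop 0] with r hr
    have f1 : r ^ a * r ^ (-(1:ℝ)) = r ^ (a - 1) := by rw [← Real.rpow_add hr]; rfl
    have f2 : r ^ a * r ^ (-(a - b)) = r ^ b := by rw [← Real.rpow_add hr]; congr 1; ring
    have f3 : r ^ a * r ^ (-(a - 1)) = r := by
      rw [← Real.rpow_add hr]; conv_rhs => rw [← Real.rpow_one r]
      congr 1; ring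
    calc _ = -κ * r ^ a + M * (r ^ a * r ^ (-(1:ℝ))) + K * (r ^ a * r ^ (-(a - b))) + r ^ a * r ^ (-(a - 1)) := by ring
      _ = _ := by rw [f1, f2, f3]
  have hlim : Tendsto g atTop (𝓝 0) := by
    have q (s : ℝ) : Tendsto (fun r : ℝ => Real.exp (-r) * r ^ s) atTop (𝓝 0) := by
      have := tendsto_rpow_mul_exp_neg_mul_atTop_nhds_zero s 1 one_pos
      refine this.congr fun x => ?_
      rw [mul_comm]; simp
    have := (Real.tendsto_exp_atBot.comp hexpo).mul ((q p).add (q (p+2)))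
    simpa [hg] using this
  have hcont : Continuous g := by
    have c (s : ℝ) (hs : 0 ≤ s) : Continuous fun r : ℝ => r ^ s := Real.continuous_rpow_const hs
    have := c a (by linarith)
    have := c (a-1) (by linarith)
    have := c b hb
    have := c p hp
    have := c (p+2) (by linarith)
    fun_prop
  obtain ⟨R, hR⟩ := eventually_atTop.1 (hlim.eventually (gt_mem_nhds one_pos))
  obtain ⟨C, hC⟩ := (isCompact_Icc (a := (0:ℝ)) (b := R)).bddAbove_image hcont.continuousOn
  refine ⟨max C 1, fun r hr => ?_⟩
  have hgr : g r ≤ max C 1 := by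
    rcases le_total R r with h | h
    · exact (hR r h).le.trans (le_max_right _ _)
    · exact (hC ⟨r, ⟨hr, h⟩, rfl⟩).trans (le_max_left _ _)
  have hpos : 0 < 1 + r ^ 2 := by positivity
  rw [← div_eq_mul_inv, le_div_iff₀ hpos]
  refine le_trans (le_of_eq ?_) hgr
  rw [hg]
  simp only
  have e2 : r ^ (p + 2) = r ^ p * r ^ 2 := by
    rw [Real.rpow_add_of_nonneg hr hp (by norm_num)]; norm_num
  rw [e2, Real.exp_add _ r]
  have : Real.exp r * Real.exp (-r) = 1 := by rw [← Real.exp_add]; simp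
  linear_combination (-(Real.exp (-κ * r ^ a + M * r ^ (a - 1) + K * r ^ b) * (r ^ p + r ^ p * r^2))) * this

lemma wl_re_cpow_le {a : ℝ} (ha : 1 < a) (v : ℂ) (hv : 0 ≤ v.re) :
    (v ^ (a:ℂ)).re ≤ Real.cos (a * (Real.pi / 2)) * ‖v‖ ^ a + (a * (Real.pi / 2)) * v.re * ‖v‖ ^ (a - 1) := by
  rcases eq_or_ne v 0 with rfl | hv0
  · rw [Complex.zero_cpow (by exact_mod_cast (by linarith : a ≠ 0))]
    simp [Real.zero_rpow (by linarith : a ≠ 0)]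
  have hn : 0 < ‖v‖ := norm_pos_iff.2 hv0
  have hre : v.re = ‖v‖ * Real.cos |v.arg| := by
    rw [Real.cos_abs, Complex.norm_mul_cos_arg]
  have hθ : |v.arg| ≤ Real.pi / 2 := Complex.abs_arg_le_pi_div_two_iff.2 hv
  rw [Complex.cpow_ofReal_re, hre]
  set θ := |v.arg| with hθd
  have hθ0 : 0 ≤ θ := abs_nonneg _
  have hc : Real.cos (v.arg * a) = Real.cos (a * θ) := by
    rw [← Real.cos_abs, abs_mul, abs_of_pos (by linarith : 0 < a), mul_comm]
  have hp : ‖v‖ * ‖v‖ ^ (a - 1) = ‖v‖ ^ a := by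
    rw [mul_comm, ← Real.rpow_add_one hn.ne']; congr 1; ring
  have key : Real.cos (a * θ) ≤ Real.cos (a * (Real.pi / 2)) + (a * (Real.pi / 2)) * Real.cos θ := by
    have h1 : Real.cos (a * θ) - Real.cos (a * (Real.pi / 2)) ≤ a * (Real.pi / 2 - θ) := by
      have h := Real.lipschitzWith_cos.dist_le_mul (a * θ) (a * (Real.pi / 2))
      rw [Real.dist_eq, Real.dist_eq] at h
      have h2 : |a * θ - a * (Real.pi / 2)| = a * (Real.pi / 2 - θ) := by
        rw [abs_sub_comm, abs_of_nonneg]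
        · ring
        · nlinarith
      rw [h2] at h
      have := (le_abs_self _).trans h
      simpa using this
    have h3 := Real.mul_le_sin (x := Real.pi / 2 - θ) (by linarith) (by linarith)
    rw [Real.sin_pi_div_two_sub] at h3
    have h4 : Real.pi / 2 - θ ≤ (Real.pi / 2) * Real.cos θ := by
      have := mul_le_mul_of_nonneg_left h3 (by positivity : 0 ≤ Real.pi / 2)
      calc _ = Real.pi / 2 * (2 / Real.pi * (Real.pi / 2 - θ)) := by field_simp
        _ ≤ _ := this
    nlinarith
  rw [hc]
  calc _ ≤ ‖v‖ ^ a * (Real.cos (a * (Real.pi / 2)) + (a * (Real.pi / 2)) * Real.cos θ) := by gcongr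
    _ = _ := by rw [← hp]; ring

lemma wl_strip {a b c : ℝ} (ha : 1 < a) (ha2 : a < 2) (hb : 0 ≤ b) (hba : b < a) (hc : 0 ≤ c) (K p : ℝ) (hp : 0 ≤ p) :
    ∃ C : ℝ, 0 ≤ C ∧ ∀ x y : ℝ, 0 ≤ x → x ≤ c →
      Real.exp (((x + y * Complex.I : ℂ) ^ (a:ℂ)).re + K * ‖(x + y * Complex.I : ℂ)‖ ^ b) * ‖(x + y * Complex.I : ℂ)‖ ^ p
        ≤ C * (1 + y ^ 2)⁻¹ := by
  have hκ : 0 < -Real.cos (a * (Real.pi / 2)) := by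
    have := Real.cos_neg_of_pi_div_two_lt_of_lt (x := a * (Real.pi / 2)) (by nlinarith [Real.pi_pos]) (by nlinarith [Real.pi_pos])
    linarith
  obtain ⟨C, hC⟩ := wl_decay hκ ha hb hba (a * (Real.pi / 2) * c) K p hp
  have hC0 : 0 ≤ C := by
    have := hC 0 le_rfl
    have h0 : 0 ≤ C * (1 + (0:ℝ)^2)⁻¹ := le_trans (by positivity) this
    simpa using h0
  refine ⟨C, hC0, fun x y hx hxc => ?_⟩
  set v : ℂ := x + y * Complex.I with hv
  have hre : v.re = x := by simp [hv]
  have him : v.im = y := by simp [hv]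
  have h1 := wl_re_cpow_le ha v (by rw [hre]; exact hx)
  rw [hre] at h1
  have hy : y ^ 2 ≤ ‖v‖ ^ 2 := by
    rw [← sq_abs y, ← him]
    gcongr
    exact Complex.abs_im_le_norm v
  calc _ ≤ Real.exp (-(-Real.cos (a * (Real.pi / 2))) * ‖v‖ ^ a + a * (Real.pi / 2) * c * ‖v‖ ^ (a - 1) + K * ‖v‖ ^ b) * ‖v‖ ^ p := by
        gcongr
        have : a * (Real.pi / 2) * x * ‖v‖ ^ (a - 1) ≤ a * (Real.pi / 2) * c * ‖v‖ ^ (a - 1) := by gcongr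
        linarith
    _ ≤ C * (1 + ‖v‖ ^ 2)⁻¹ := hC _ (norm_nonneg _)
    _ ≤ _ := by gcongr

lemma wl_line {a b c : ℝ} (ha : 1 < a) (ha2 : a < 2) (hb : 0 ≤ b) (hba : b < a) (hc : 0 < c) (K p : ℝ) :
    ∃ C : ℝ, 0 ≤ C ∧ ∀ y : ℝ,
      Real.exp (((c + y * Complex.I : ℂ) ^ (a:ℂ)).re + K * ‖(c + y * Complex.I : ℂ)‖ ^ b) * ‖(c + y * Complex.I : ℂ)‖ ^ p
        ≤ C * (1 + y ^ 2)⁻¹ := by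
  rcases le_total 0 p with hp | hp
  · obtain ⟨C, hC0, hC⟩ := wl_strip ha ha2 hb hba hc.le K p hp
    exact ⟨C, hC0, fun y => hC c y hc.le le_rfl⟩
  · obtain ⟨C, hC0, hC⟩ := wl_strip ha ha2 hb hba hc.le K 0 le_rfl
    refine ⟨C * c ^ p, by positivity, fun y => ?_⟩
    have h := hC c y hc.le le_rfl
    rw [Real.rpow_zero, mul_one] at h
    have hcn : c ≤ ‖(c + y * Complex.I : ℂ)‖ := by
      have := Complex.abs_re_le_norm (c + y * Complex.I : ℂ)
      simp at this
      exact (le_abs_self c).trans this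
    have h2 := Real.rpow_le_rpow_of_nonpos hc hcn hp
    calc _ ≤ C * (1 + y ^ 2)⁻¹ * c ^ p := by gcongr
      _ = _ := by ring
/-- The integrand of the Hankel type integral along the line of real part `c`. -/
noncomputable def wlH (a p : ℝ) (v : ℂ) : ℂ := Complex.exp (v ^ (a:ℂ)) * v ^ (p:ℂ)

lemma wlH_norm (a p : ℝ) (v : ℂ) : ‖wlH a p v‖ = Real.exp ((v ^ (a:ℂ)).re) * ‖v‖ ^ p := by
  rw [wlH, norm_mul, Complex.norm_exp, Complex.norm_cpow_real]

lemma wl_slit {c : ℝ} (hc : 0 < c) (y : ℝ) : (c + y * Complex.I : ℂ) ∈ Complex.slitPlane := by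
  left; simpa using hc

lemma wl_cont_cpow {c : ℝ} (hc : 0 < c) (p : ℝ) :
    Continuous fun y : ℝ => (c + y * Complex.I : ℂ) ^ (p:ℂ) := by
  refine Continuous.cpow (by fun_prop) continuous_const fun y => wl_slit hc y

lemma wlH_cont {a c : ℝ} (hc : 0 < c) (p : ℝ) :
    Continuous fun y : ℝ => wlH a p (c + y * Complex.I) := by
  have h1 := wl_cont_cpow hc p
  have h2 := wl_cont_cpow hc a
  unfold wlH
  fun_prop

lemma wlH_integrable {a c : ℝ} (ha : 1 < a) (ha2 : a < 2) (hc : 0 < c) (p : ℝ) :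
    Integrable fun y : ℝ => wlH a p (c + y * Complex.I) := by
  obtain ⟨C, -, hC⟩ := wl_line ha ha2 le_rfl (by linarith : (0:ℝ) < a) hc 0 p
  refine (integrable_inv_one_add_sq.const_mul C).mono' (wlH_cont hc p).aestronglyMeasurable ?_
  filter_upwards with y
  rw [wlH_norm]
  simpa using hC y

noncomputable def wlJ (a c p : ℝ) : ℂ := ∫ y : ℝ, wlH a p (c + y * Complex.I)

lemma wl_tendsto_inv_top (C : ℝ) :
    Filter.Tendsto (fun y : ℝ => C * (1 + y ^ 2)⁻¹) Filter.atTop (nhds 0) := by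
  have : Filter.Tendsto (fun y : ℝ => 1 + y ^ 2) Filter.atTop Filter.atTop :=
    Filter.tendsto_atTop_add_const_left _ _ (Filter.tendsto_pow_atTop two_ne_zero)
  simpa using this.inv_tendsto_atTop.const_mul C

lemma wlJ_rec {a c : ℝ} (ha : 1 < a) (ha2 : a < 2) (hc : 0 < c) (p : ℝ) :
    ((p + 1 : ℝ) : ℂ) * wlJ a c p = - a * wlJ a c (p + a) := by
  have hder : ∀ y : ℝ, HasDerivAt (fun y : ℝ => wlH a (p + 1) (c + y * Complex.I))
      (Complex.I * (a * wlH a (p + a) (c + y * Complex.I) + ((p + 1 : ℝ) : ℂ) * wlH a p (c + y * Complex.I))) y := by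
    intro y
    have hs := wl_slit hc y
    have hl : HasDerivAt (fun y : ℝ => (c + y * Complex.I : ℂ)) Complex.I y := by
      have := ((Complex.ofRealCLM.hasDerivAt (x := y)).mul_const Complex.I).const_add (c:ℂ)
      simpa using this
    have hv : HasDerivAt (wlH a (p + 1)) (a * wlH a (p + a) (c + y * Complex.I) + ((p + 1 : ℝ) : ℂ) * wlH a p (c + y * Complex.I))
        (c + y * Complex.I) := by
      set v : ℂ := c + y * Complex.I
      have d1 := (hasDerivAt_id v).cpow_const (c := (a:ℂ)) hs
      have d2 := (hasDerivAt_id v).cpow_const (c := ((p+1:ℝ):ℂ)) hs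
      have := d1.cexp.mul d2
      refine this.congr_deriv ?_
      have hv0 : v ≠ 0 := Complex.slitPlane_ne_zero hs
      simp only [wlH, id]
      have e1 : v ^ ((p + a : ℝ):ℂ) = v ^ ((a:ℂ) - 1) * v ^ ((p+1:ℝ):ℂ) := by
        rw [← Complex.cpow_add _ _ hv0]; congr 1; push_cast; ring
      have e2 : v ^ (((p+1:ℝ):ℂ) - 1) = v ^ (p:ℂ) := by congr 1; push_cast; ring
      rw [e1, e2]; ring
    have := hv.scomp y hl
    simpa [Function.comp_def] using this
  have hbd (l : Filter ℝ) (hl : ∀ C : ℝ, Filter.Tendsto (fun y : ℝ => C * (1 + y ^ 2)⁻¹) l (nhds 0)) :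
      Filter.Tendsto (fun y : ℝ => wlH a (p + 1) (c + y * Complex.I)) l (nhds 0) := by
    obtain ⟨C, -, hC⟩ := wl_line ha ha2 le_rfl (by linarith : (0:ℝ) < a) hc 0 (p + 1)
    refine squeeze_zero_norm (fun y => ?_) (hl C)
    rw [wlH_norm]
    simpa using hC y
  have hi := integral_of_hasDerivAt_of_tendsto hder
    ((((wlH_integrable ha ha2 hc (p+a)).const_mul (a:ℂ)).add ((wlH_integrable ha ha2 hc p).const_mul ((p+1:ℝ):ℂ))).const_mul Complex.I)
    (hbd _ fun C => by simpa using (wl_tendsto_inv_top C).comp Filter.tendsto_neg_atBot_atTop |>.congr fun y => by simp)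
    (hbd _ wl_tendsto_inv_top)
  rw [integral_const_mul, integral_add ((wlH_integrable ha ha2 hc (p+a)).const_mul (a:ℂ))
    ((wlH_integrable ha ha2 hc p).const_mul ((p+1:ℝ):ℂ)), integral_const_mul, integral_const_mul, sub_zero] at hi
  have := (mul_eq_zero.1 hi).resolve_left Complex.I_ne_zero
  change (a:ℂ) * wlJ a c (p + a) + _ * wlJ a c p = 0 at this
  linear_combination this

lemma wlJ_contAt {a c : ℝ} (ha : 1 < a) (ha2 : a < 2) (hc : 0 < c) (p : ℝ) :
    ContinuousAt (fun p => wlJ a c p) p := by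
  unfold wlJ
  refine continuousAt_of_dominated
    (bound := fun y => ‖wlH a (p - 1) (c + y * Complex.I)‖ + ‖wlH a (p + 1) (c + y * Complex.I)‖) ?_ ?_ ?_ ?_
  · exact Filter.Eventually.of_forall fun q => (wlH_cont hc q).aestronglyMeasurable
  · filter_upwards [Ioo_mem_nhds (by linarith : p - 1 < p) (by linarith : p < p + 1)] with q hq
    filter_upwards with y
    simp only [wlH_norm]
    rw [← mul_add]
    gcongr
    set r := ‖(c + y * Complex.I : ℂ)‖
    have hr : 0 < r := norm_pos_iff.2 (Complex.slitPlane_ne_zero (wl_slit hc y))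
    rcases le_total 1 r with h | h
    · have := Real.rpow_le_rpow_of_exponent_le h hq.2.le
      have : 0 ≤ r ^ (p - 1) := by positivity
      linarith
    · have := Real.rpow_le_rpow_of_exponent_ge hr h hq.1.le
      have : 0 ≤ r ^ (p + 1) := by positivity
      linarith
  · exact (wlH_integrable ha ha2 hc _).norm.add (wlH_integrable ha ha2 hc _).norm
  · filter_upwards with y
    unfold wlH
    have : (c + y * Complex.I : ℂ) ≠ 0 := Complex.slitPlane_ne_zero (wl_slit hc y)
    refine ContinuousAt.mul continuousAt_const ?_
    exact ContinuousAt.const_cpow (by fun_prop) (Or.inl this)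

/-- Gamma integral with complex rate. -/
lemma wl_gamma_rot {q : ℝ} (hq : 1 ≤ q) {r : ℂ} (hr : 0 < r.re) :
    ∫ t in Set.Ioi (0:ℝ), ((t ^ (q - 1) : ℝ) : ℂ) * Complex.exp (-(r * t)) = r ^ (-(q:ℂ)) * Complex.Gamma q := by
  set F : ℂ → ℂ := fun r => ∫ t in Set.Ioi (0:ℝ), ((t ^ (q - 1) : ℝ) : ℂ) * Complex.exp (-(r * t)) with hF
  set G : ℂ → ℂ := fun r => r ^ (-(q:ℂ)) * Complex.Gamma q with hG
  set U : Set ℂ := {r | 0 < r.re} with hU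
  have hUo : IsOpen U := isOpen_lt continuous_const Complex.continuous_re
  have hcr : Continuous fun t : ℝ => t ^ (q - 1) := Real.continuous_rpow_const (by linarith)
  have hmeas (r : ℂ) : AEStronglyMeasurable (fun t : ℝ => ((t ^ (q - 1) : ℝ) : ℂ) * Complex.exp (-(r * t)))
      (volume.restrict (Set.Ioi 0)) := by
    apply Continuous.aestronglyMeasurable
    fun_prop
  have hint (s δ : ℝ) (hs : 0 ≤ s) (hδ : 0 < δ) : IntegrableOn (fun t : ℝ => t ^ s * Real.exp (-δ * t)) (Set.Ioi 0) := by
    have := integrableOn_rpow_mul_exp_neg_mul_rpow (p := 1) (s := s) (b := δ) (by linarith) one_pos hδ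
    simpa using this
  have hFd : DifferentiableOn ℂ F U := by
    intro r0 hr0
    have hr0' : 0 < r0.re := hr0
    refine DifferentiableAt.differentiableWithinAt ?_
    have := hasDerivAt_integral_of_dominated_loc_of_deriv_le (μ := volume.restrict (Set.Ioi (0:ℝ)))
      (F := fun (r : ℂ) (t : ℝ) => ((t ^ (q - 1) : ℝ) : ℂ) * Complex.exp (-(r * t)))
      (F' := fun (r : ℂ) (t : ℝ) => ((t ^ (q - 1) : ℝ) : ℂ) * (Complex.exp (-(r * t)) * (-t)))
      (x₀ := r0) (s := {r | r0.re / 2 < r.re})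
      (bound := fun t => t ^ q * Real.exp (-(r0.re / 2) * t))
      ((isOpen_lt continuous_const Complex.continuous_re).mem_nhds (by simp; linarith))
      (Filter.Eventually.of_forall hmeas) ?_ ?_ ?_ ?_ ?_
    · exact this.2.differentiableAt
    · refine (hint (q-1) r0.re (by linarith) hr0').mono' (hmeas r0) ?_
      filter_upwards [ae_restrict_mem measurableSet_Ioi] with t ht
      have ht : 0 < t := ht
      rw [norm_mul, Complex.norm_exp, Complex.norm_real, Real.norm_of_nonneg (by positivity)]
      simp
    · apply Continuous.aestronglyMeasurable
      fun_prop
    · filter_upwards [ae_restrict_mem measurableSet_Ioi] with t ht r hr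
      have ht : 0 < t := ht
      have hr : r0.re / 2 < r.re := hr
      rw [norm_mul, norm_mul, Complex.norm_exp, Complex.norm_real, Real.norm_of_nonneg (by positivity), norm_neg,
        Complex.norm_real, Real.norm_of_nonneg ht.le]
      have e : t ^ q = t ^ (q - 1) * t := by rw [← Real.rpow_add_one ht.ne']; congr 1; ring
      rw [e]
      have : (-(r * t)).re ≤ -(r0.re / 2) * t := by
        simp; nlinarith
      calc _ = t ^ (q-1) * t * Real.exp ((-(r * t)).re) := by ring
        _ ≤ _ := by gcongr
    · exact hint q _ (by linarith) (by linarith)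
    · filter_upwards with t r hr
      have h1 : HasDerivAt (fun r : ℂ => -(r * t)) (-t) r := by
        simpa [Pi.neg_def] using ((hasDerivAt_id r).mul_const (t:ℂ)).neg
      exact h1.cexp.const_mul _
  have hGd : DifferentiableOn ℂ G U := by
    intro r0 hr0
    refine DifferentiableAt.differentiableWithinAt ?_
    have := (hasDerivAt_id r0).cpow_const (c := -(q:ℂ)) (Or.inl hr0)
    exact this.differentiableAt.mul_const _
  have hpre : IsPreconnected U := (convex_halfSpace_re_gt 0).isPreconnected
  refine (hFd.analyticOnNhd hUo).eqOn_of_preconnected_of_frequently_eq (hGd.analyticOnNhd hUo) hpre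
    (z₀ := 1) (by simp [hU]) ?_ hr
  have hreal : ∀ x : ℝ, 0 < x → F x = G x := by
    intro x hx
    have := Complex.integral_cpow_mul_exp_neg_mul_Ioi (a := q) (r := x) (by simp; linarith) hx
    rw [hF, hG]
    simp only
    rw [Complex.cpow_neg, ← Complex.inv_cpow, ← one_div, ← this]
    · refine setIntegral_congr_fun measurableSet_Ioi fun t ht => ?_
      have ht : 0 < t := ht
      rw [Complex.ofReal_cpow ht.le]; push_cast; rfl
    · rw [Complex.arg_ofReal_of_nonneg hx.le]; exact Real.pi_pos.ne
  have ht : Filter.Tendsto (fun n : ℕ => ((1 + 1 / ((n:ℝ) + 1) : ℝ) : ℂ)) Filter.atTop (nhdsWithin 1 {1}ᶜ) := by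
    refine tendsto_nhdsWithin_iff.2 ⟨?_, ?_⟩
    · have := (tendsto_one_div_add_atTop_nhds_zero_nat (𝕜 := ℝ)).const_add 1
      have := (Complex.continuous_ofReal.tendsto _).comp this
      simpa [Function.comp_def] using this
    · filter_upwards with n
      simp only [Set.mem_compl_iff, Set.mem_singleton_iff]
      norm_cast
      have : 0 < 1 / ((n:ℝ) + 1) := by positivity
      push_cast
      linarith
  refine ht.frequently (Filter.Frequently.of_forall fun n => hreal _ (by positivity))
lemma wl_real_mul_cpow {y : ℝ} (hy : 0 < y) {w : ℂ} (hw : w ≠ 0) (s : ℝ) :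
    ((y:ℂ) * w) ^ (s:ℂ) = ((y ^ s : ℝ) : ℂ) * w ^ (s:ℂ) := by
  have hy' : (y:ℂ) ≠ 0 := by exact_mod_cast hy.ne'
  rw [Complex.cpow_def_of_ne_zero (mul_ne_zero hy' hw), Complex.log_ofReal_mul hy hw, add_mul, Complex.exp_add,
    Complex.ofReal_cpow hy.le, Complex.cpow_def_of_ne_zero hy', Complex.cpow_def_of_ne_zero hw, Complex.ofReal_log hy.le]

lemma wl_ray {a p : ℝ} (ha : 1 < a) (ha2 : a < 2) (hp : 1 ≤ p) {w : ℂ} (hw : w ≠ 0) (hwr : 0 < (-(w ^ (a:ℂ))).re) :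
    ∫ y in Set.Ioi (0:ℝ), wlH a p (y * w) =
      (1 / a) * w ^ (p:ℂ) * ((-(w ^ (a:ℂ))) ^ (-(((p + 1) / a : ℝ):ℂ)) * Complex.Gamma (((p + 1) / a : ℝ):ℂ)) := by
  have ha0 : a ≠ 0 := by linarith
  have hq : 1 ≤ (p + 1) / a := by rw [le_div_iff₀ (by linarith)]; linarith
  rw [← wl_gamma_rot hq hwr, ← integral_comp_rpow_Ioi_of_pos (p := a)
    (g := fun t : ℝ => ((t ^ ((p + 1) / a - 1) : ℝ) : ℂ) * Complex.exp (-(-(w ^ (a:ℂ)) * t))) (by linarith), ← integral_const_mul]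
  refine setIntegral_congr_fun measurableSet_Ioi fun y hy => ?_
  have hy : 0 < y := hy
  simp only [wlH]
  rw [wl_real_mul_cpow hy hw, wl_real_mul_cpow hy hw]
  have e : y ^ p = y ^ (a - 1) * (y ^ a) ^ ((p + 1) / a - 1) := by
    rw [← Real.rpow_mul hy.le, ← Real.rpow_add hy]
    congr 1; field_simp; ring
  rw [e]
  have e2 : -(-w ^ (a:ℂ) * ((y ^ a : ℝ):ℂ)) = ((y ^ a : ℝ):ℂ) * w ^ (a:ℂ) := by ring
  rw [e2]
  have : (a:ℂ) ≠ 0 := by exact_mod_cast ha0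
  rw [Complex.real_smul]
  push_cast
  field_simp

lemma wl_strip_cont {a p : ℝ} (ha : 1 < a) (hp : 1 ≤ p) {v : ℂ} (hv : 0 ≤ v.re) : ContinuousAt (wlH a p) v := by
  unfold wlH
  have h1 := Complex.continuousAt_cpow_const_of_re_pos (z := v) (w := a) (Or.inl hv) (by simp; linarith)
  have h2 := Complex.continuousAt_cpow_const_of_re_pos (z := v) (w := p) (Or.inl hv) (by simp; linarith)
  exact h1.cexp.mul h2

lemma wl_axis_integrable {a p : ℝ} (ha : 1 < a) (ha2 : a < 2) (hp : 1 ≤ p) :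
    Integrable fun y : ℝ => wlH a p (y * Complex.I) := by
  obtain ⟨C, -, hC⟩ := wl_strip ha ha2 le_rfl (by linarith : (0:ℝ) < a) le_rfl 0 p (by linarith)
  refine (integrable_inv_one_add_sq.const_mul C).mono' (Continuous.aestronglyMeasurable ?_) ?_
  · refine continuous_iff_continuousAt.2 fun y => ?_
    exact ContinuousAt.comp (f := fun y : ℝ => (y * Complex.I : ℂ)) (wl_strip_cont ha hp (by simp)) (by fun_prop)
  · filter_upwards with y
    rw [wlH_norm]
    simpa using hC 0 y le_rfl le_rfl

lemma wlJ_shift {a c p : ℝ} (ha : 1 < a) (ha2 : a < 2) (hc : 0 < c) (hp : 1 ≤ p) :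
    wlJ a c p = ∫ y : ℝ, wlH a p (y * Complex.I) := by
  obtain ⟨C, hC0, hC⟩ := wl_strip ha ha2 le_rfl (by linarith : (0:ℝ) < a) hc.le 0 p (by linarith)
  have hrect (T : ℝ) := Complex.integral_boundary_rect_eq_zero_of_continuousOn_of_differentiableOn (wlH a p)
    (⟨0, -T⟩ : ℂ) (⟨c, T⟩ : ℂ) (fun v hv => by
      have : 0 ≤ v.re := by
        have := hv.1
        simp only [Set.uIcc_of_le hc.le, Set.mem_preimage] at this
        exact this.1
      exact (wl_strip_cont ha hp this).continuousWithinAt) (fun v hv => by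
      have : 0 < v.re := by
        have := hv.1
        simp only [min_eq_left hc.le, Set.mem_preimage] at this
        exact this.1
      refine DifferentiableAt.differentiableWithinAt ?_
      have d1 := (hasDerivAt_id v).cpow_const (c := (a:ℂ)) (Or.inl this)
      have d2 := (hasDerivAt_id v).cpow_const (c := (p:ℂ)) (Or.inl this)
      exact (d1.cexp.mul d2).differentiableAt)
  simp only at hrect
  have hb (T : ℝ) : ‖∫ x in (0:ℝ)..c, wlH a p (x + T * Complex.I)‖ ≤ (C * (1 + T ^ 2)⁻¹) * |c - 0| := by
    refine intervalIntegral.norm_integral_le_of_norm_le_const fun x hx => ?_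
    rw [Set.uIoc_of_le hc.le] at hx
    rw [wlH_norm]
    simpa using hC x T hx.1.le hx.2
  have t1 : Filter.Tendsto (fun T : ℝ => ∫ x in (0:ℝ)..c, wlH a p (x + T * Complex.I)) Filter.atTop (nhds 0) := by
    refine squeeze_zero_norm hb ?_
    simpa using (wl_tendsto_inv_top C).mul_const |c - 0|
  have t2 : Filter.Tendsto (fun T : ℝ => ∫ x in (0:ℝ)..c, wlH a p (x + (-T : ℝ) * Complex.I)) Filter.atTop (nhds 0) := by
    refine squeeze_zero_norm (fun T => hb (-T)) ?_
    simpa using (wl_tendsto_inv_top C).mul_const |c - 0|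
  have t3 := intervalIntegral_tendsto_integral (wlH_integrable ha ha2 hc p) Filter.tendsto_neg_atTop_atBot Filter.tendsto_id
  have t4 := intervalIntegral_tendsto_integral (wl_axis_integrable ha ha2 hp) Filter.tendsto_neg_atTop_atBot Filter.tendsto_id
  have t5 := ((t2.sub t1).add (t3.const_smul Complex.I)).sub (t4.const_smul Complex.I)
  have := tendsto_nhds_unique t5 ((tendsto_const_nhds (x := (0:ℂ))).congr fun T => by
    rw [← hrect T]; simp)
  simp only [sub_zero, zero_add, smul_eq_mul, ← mul_sub] at this
  have := (mul_eq_zero.1 this).resolve_left Complex.I_ne_zero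
  exact sub_eq_zero.1 this

lemma wlJ_base {a c p : ℝ} (ha : 1 < a) (ha2 : a < 2) (hc : 0 < c) (hp : 1 ≤ p) :
    wlJ a c p = (2 * Real.pi / a) * (Complex.Gamma (1 - (p + 1) / a))⁻¹ := by
  have hpi := Real.pi_pos
  have ha0 : (a:ℂ) ≠ 0 := by exact_mod_cast (by linarith : a ≠ 0)
  have hIa : Complex.I ^ (a:ℂ) = Complex.exp (((a * (Real.pi / 2) : ℝ) : ℂ) * Complex.I) := by
    rw [Complex.cpow_def_of_ne_zero Complex.I_ne_zero, Complex.log_I]; congr 1; push_cast; ring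
  have hIp : Complex.I ^ (p:ℂ) = Complex.exp (((p * (Real.pi / 2) : ℝ) : ℂ) * Complex.I) := by
    rw [Complex.cpow_def_of_ne_zero Complex.I_ne_zero, Complex.log_I]; congr 1; push_cast; ring
  have hnI : -Complex.I ≠ 0 := neg_ne_zero.2 Complex.I_ne_zero
  have hJa : (-Complex.I) ^ (a:ℂ) = Complex.exp (((-(a * (Real.pi / 2)) : ℝ) : ℂ) * Complex.I) := by
    rw [Complex.cpow_def_of_ne_zero hnI, Complex.log_neg_I]; congr 1; push_cast; ring
  have hJp : (-Complex.I) ^ (p:ℂ) = Complex.exp (((-(p * (Real.pi / 2)) : ℝ) : ℂ) * Complex.I) := by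
    rw [Complex.cpow_def_of_ne_zero hnI, Complex.log_neg_I]; congr 1; push_cast; ring
  have hcos : Real.cos (a * (Real.pi / 2)) < 0 :=
    Real.cos_neg_of_pi_div_two_lt_of_lt (by nlinarith) (by nlinarith)
  have hr1 : 0 < (-(Complex.I ^ (a:ℂ))).re := by
    rw [hIa, Complex.neg_re, Complex.exp_ofReal_mul_I_re]; linarith
  have hr2 : 0 < (-((-Complex.I) ^ (a:ℂ))).re := by
    rw [hJa, Complex.neg_re, Complex.exp_ofReal_mul_I_re, Real.cos_neg]; linarith
  have hm1 : -(Complex.I ^ (a:ℂ)) = Complex.exp (((a * (Real.pi / 2) - Real.pi : ℝ) : ℂ) * Complex.I) := by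
    rw [hIa]; push_cast; rw [sub_mul, Complex.exp_sub, Complex.exp_pi_mul_I]; ring
  have hm2 : -((-Complex.I) ^ (a:ℂ)) = Complex.exp (((-(a * (Real.pi / 2) - Real.pi) : ℝ) : ℂ) * Complex.I) := by
    rw [hJa]; push_cast; rw [neg_sub, sub_mul, sub_eq_add_neg, Complex.exp_add, Complex.exp_pi_mul_I, neg_mul]; ring
  have hlog (x : ℝ) (h1 : -Real.pi < x) (h2 : x ≤ Real.pi) (s : ℂ) :
      (Complex.exp ((x:ℂ) * Complex.I)) ^ s = Complex.exp (x * Complex.I * s) := by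
    rw [Complex.cpow_def_of_ne_zero (Complex.exp_ne_zero _), Complex.log_exp (by simpa using h1) (by simpa using h2)]
  have hi := wl_axis_integrable ha ha2 hp
  rw [wlJ_shift ha ha2 hc hp, ← intervalIntegral.integral_Iic_add_Ioi (b := 0) hi.integrableOn hi.integrableOn]
  have hneg := integral_comp_neg_Ioi (0:ℝ) (fun y : ℝ => wlH a p (y * Complex.I))
  rw [neg_zero] at hneg
  rw [← hneg]
  have hneg2 : ∫ y in Set.Ioi (0:ℝ), wlH a p (((-y : ℝ):ℂ) * Complex.I) = ∫ y in Set.Ioi (0:ℝ), wlH a p (y * (-Complex.I)) := by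
    congr 1; ext y; congr 1; push_cast; ring
  rw [hneg2, wl_ray ha ha2 hp hnI hr2, wl_ray ha ha2 hp Complex.I_ne_zero hr1, hm1, hm2, hIp, hJp,
    hlog _ (by nlinarith) (by nlinarith), hlog _ (by nlinarith) (by nlinarith)]
  set q : ℝ := (p + 1) / a with hq
  have haq : a * q = p + 1 := by rw [hq]; field_simp
  have hq0 : 0 < q := by rw [hq]; positivity
  have hgoal : (1 - (p + 1) / a : ℂ) = 1 - (q:ℂ) := by rw [hq]; push_cast; rfl
  rw [hgoal]
  have hrefl := Complex.Gamma_mul_Gamma_one_sub (q:ℂ)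
  have hGq : Complex.Gamma (q:ℂ) ≠ 0 := Complex.Gamma_ne_zero_of_re_pos (by simpa using hq0)
  have hinv : (Complex.Gamma (1 - (q:ℂ)))⁻¹ = Complex.Gamma q * Complex.sin (Real.pi * q) / Real.pi := by
    have : Complex.Gamma (1 - (q:ℂ)) = Real.pi / Complex.sin (Real.pi * q) / Complex.Gamma q := by
      rw [← hrefl]; field_simp
    rw [this, inv_div, div_div_eq_mul_div]
  have s1 : Complex.exp (((-(p * (Real.pi / 2)) : ℝ) : ℂ) * Complex.I) * Complex.exp (((-(a * (Real.pi / 2) - Real.pi) : ℝ):ℂ) * Complex.I * (-(q:ℂ)))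
      = Complex.exp (-(Real.pi * q) * Complex.I) * Complex.I := by
    rw [← Complex.exp_add]
    rw [show Complex.exp (-(Real.pi * q) * Complex.I) * Complex.I
      = Complex.exp (-(Real.pi * q) * Complex.I) * Complex.exp (Real.pi / 2 * Complex.I) by
        rw [Complex.exp_pi_div_two_mul_I], ← Complex.exp_add]
    congr 1
    have : (a:ℂ) * q = p + 1 := by exact_mod_cast haq
    push_cast
    linear_combination (Real.pi / 2 * Complex.I) * this
  have s2 : Complex.exp (((p * (Real.pi / 2) : ℝ) : ℂ) * Complex.I) * Complex.exp (((a * (Real.pi / 2) - Real.pi : ℝ):ℂ) * Complex.I * (-(q:ℂ)))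
      = Complex.exp ((Real.pi * q) * Complex.I) * (-Complex.I) := by
    rw [← Complex.exp_add]
    rw [show Complex.exp ((Real.pi * q) * Complex.I) * (-Complex.I)
      = Complex.exp ((Real.pi * q) * Complex.I) * Complex.exp (-Real.pi / 2 * Complex.I) by
        rw [Complex.exp_neg_pi_div_two_mul_I], ← Complex.exp_add]
    congr 1
    have : (a:ℂ) * q = p + 1 := by exact_mod_cast haq
    push_cast
    linear_combination (-Real.pi / 2 * Complex.I) * this
  rw [hinv, Complex.sin]
  have hpc : (Real.pi : ℂ) ≠ 0 := by exact_mod_cast hpi.ne'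
  calc _ = 1 / (a:ℂ) * Complex.Gamma q * ((Complex.exp (((-(p * (Real.pi / 2)) : ℝ) : ℂ) * Complex.I) * Complex.exp (((-(a * (Real.pi / 2) - Real.pi) : ℝ):ℂ) * Complex.I * (-(q:ℂ)))) + (Complex.exp (((p * (Real.pi / 2) : ℝ) : ℂ) * Complex.I) * Complex.exp (((a * (Real.pi / 2) - Real.pi : ℝ):ℂ) * Complex.I * (-(q:ℂ))))) := by ring
    _ = _ := by rw [s1, s2]; field_simp; ring

lemma wlJ_eq {a c : ℝ} (ha : 1 < a) (ha2 : a < 2) (hc : 0 < c) (p : ℝ) :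
    wlJ a c p = (2 * Real.pi / a) * (Complex.Gamma (1 - (p + 1) / a))⁻¹ := by
  have ha0 : (a:ℂ) ≠ 0 := by exact_mod_cast (by linarith : a ≠ 0)
  set G : ℝ → ℂ := fun p => (2 * Real.pi / a) * (Complex.Gamma (1 - (p + 1) / a))⁻¹ with hG
  have hGc : Continuous G := by
    have := Complex.differentiable_one_div_Gamma.continuous
    have h2 : Continuous fun p : ℝ => (1 - (p + 1) / a : ℂ) := by fun_prop
    exact continuous_const.mul (this.comp h2)
  have hGr (p : ℝ) : ((p + 1 : ℝ) : ℂ) * G p = - a * G (p + a) := by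
    have := Complex.one_div_Gamma_eq_self_mul_one_div_Gamma_add_one (1 - (p + a + 1) / a)
    have e : (1 - (p + a + 1) / a : ℂ) + 1 = 1 - (p + 1) / a := by field_simp; ring
    rw [e] at this
    simp only [hG]
    push_cast
    rw [this]
    field_simp
    ring
  have main : ∀ n : ℕ, ∀ p : ℝ, 1 - n * 1 < p → wlJ a c p = G p := by
    intro n
    induction n with
    | zero => intro p hp; exact wlJ_base ha ha2 hc (by simp at hp; exact hp.le)
    | succ n ih =>
      have h1 : ∀ p : ℝ, 1 - ((n + 1 : ℕ):ℝ) * 1 < p → p ≠ -1 → wlJ a c p = G p := by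
        intro p hp hp1
        have h := wlJ_rec ha ha2 hc p
        rw [ih (p + a) (by push_cast at hp; linarith), ← hGr] at h
        refine mul_left_cancel₀ ?_ h
        norm_cast
        intro h; apply hp1; linarith
      intro p hp
      rcases eq_or_ne p (-1) with rfl | hne
      · have l1 := (wlJ_contAt ha ha2 hc (-1)).tendsto.mono_left (nhdsWithin_le_nhds (s := {(-1)}ᶜ))
        have l2 := (hGc.tendsto (-1)).mono_left (nhdsWithin_le_nhds (s := {(-1)}ᶜ))
        refine tendsto_nhds_unique (l1.congr' ?_) l2
        filter_upwards [self_mem_nhdsWithin, nhdsWithin_le_nhds (Ioi_mem_nhds hp)] with x hx hx2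
        exact h1 x hx2 hx
      · exact h1 p hp hne
  obtain ⟨n, hn⟩ := exists_nat_gt (1 - p)
  exact main n p (by linarith)
lemma wl_hs {f g : ℕ → ℂ} {x y : ℂ} (h : HasSum f x) (hf : ∀ n, g n = f n) (hx : y = x) : HasSum g y := by
  have : g = f := funext hf
  subst this
  subst hx
  exact h

lemma wlH_mul_pow (a b p : ℝ) {v : ℂ} (hv : v ≠ 0) (n : ℕ) :
    wlH a (b * n + p) v = wlH a p v * (v ^ (b:ℂ)) ^ n := by
  unfold wlH
  rw [← Complex.cpow_mul_nat, mul_assoc, ← Complex.cpow_add _ _ hv]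
  congr 2; push_cast; ring

lemma wl_cexp_hasSum (x : ℂ) : HasSum (fun n : ℕ => x ^ n / n.factorial) (Complex.exp x) := by
  rw [Complex.exp_eq_exp_ℂ]; exact NormedSpace.expSeries_div_hasSum_exp x

lemma wl_rexp_hasSum (x : ℝ) : HasSum (fun n : ℕ => x ^ n / n.factorial) (Real.exp x) := by
  rw [Real.exp_eq_exp_ℝ]; exact NormedSpace.expSeries_div_hasSum_exp x

lemma wl_wright_rep {a γ c : ℝ} (ha : 1 < a) (ha2 : a < 2) (hγ : 0 < γ) (hγ1 : γ < 1) (hc : 0 < c)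
    {t : ℝ} (ht : 0 ≤ t) :
    (wright γ t : ℂ) = (a / (2 * Real.pi)) *
      ∫ y : ℝ, wlH a (a * γ - 1) (c + y * Complex.I) * Complex.exp (-t * (c + y * Complex.I : ℂ) ^ ((a * γ : ℝ) : ℂ)) := by
  have ha0 : (a:ℂ) ≠ 0 := by exact_mod_cast (by linarith : a ≠ 0)
  have hpi : (Real.pi : ℂ) ≠ 0 := by exact_mod_cast Real.pi_ne_zero
  set b := a * γ with hb
  have hb0 : 0 < b := by positivity
  have hba : b < a := by rw [hb]; nlinarith
  have hv0 (y : ℝ) : (c + y * Complex.I : ℂ) ≠ 0 := Complex.slitPlane_ne_zero (wl_slit hc y)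
  have hbs (y : ℝ) : HasSum (fun n : ℕ => Real.exp (((c + y * Complex.I : ℂ) ^ (a:ℂ)).re) * ‖(c + y * Complex.I : ℂ)‖ ^ (b - 1) *
      ((t * ‖(c + y * Complex.I : ℂ)‖ ^ b) ^ n / n.factorial))
      (Real.exp (((c + y * Complex.I : ℂ) ^ (a:ℂ)).re) * ‖(c + y * Complex.I : ℂ)‖ ^ (b - 1) * Real.exp (t * ‖(c + y * Complex.I : ℂ)‖ ^ b)) :=
    (wl_rexp_hasSum _).mul_left _
  have key := hasSum_integral_of_dominated_convergence (μ := (volume : Measure ℝ))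
    (F := fun (n : ℕ) (y : ℝ) => ((-t : ℂ) ^ n / n.factorial) * wlH a (b * n + (b - 1)) (c + y * Complex.I))
    (f := fun y => wlH a (b - 1) (c + y * Complex.I) * Complex.exp (-t * (c + y * Complex.I : ℂ) ^ (b : ℂ)))
    (fun n y => Real.exp (((c + y * Complex.I : ℂ) ^ (a:ℂ)).re) * ‖(c + y * Complex.I : ℂ)‖ ^ (b - 1) *
      ((t * ‖(c + y * Complex.I : ℂ)‖ ^ b) ^ n / n.factorial)) ?_ ?_ ?_ ?_ ?_
  · have h2 : HasSum (fun n : ℕ => (2 * Real.pi / a) * (((-t) ^ n / (n.factorial * Real.Gamma (1 - γ - γ * n)) : ℝ) : ℂ))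
        (∫ y : ℝ, wlH a (b - 1) (c + y * Complex.I) * Complex.exp (-t * (c + y * Complex.I : ℂ) ^ (b : ℂ))) := by
      refine wl_hs key (fun n => ?_) rfl
      rw [integral_const_mul]
      change _ = _ * wlJ a c (b * n + (b - 1))
      rw [wlJ_eq ha ha2 hc]
      have e : (1 - (((b * n + (b - 1) : ℝ):ℂ) + 1) / a) = ((1 - γ - γ * n : ℝ) : ℂ) := by
        rw [hb]; push_cast; field_simp; ring
      rw [e, Complex.Gamma_ofReal]
      push_cast
      rw [div_eq_mul_inv _ (_ * _), mul_inv, div_eq_mul_inv _ (n.factorial : ℂ)]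
      ring
    have h3 := h2.mul_left ((a:ℂ) / (2 * Real.pi))
    have h4 : HasSum (fun n : ℕ => (((-t) ^ n / (n.factorial * Real.Gamma (1 - γ - γ * n)) : ℝ) : ℂ))
       ((a / (2 * Real.pi)) * ∫ y : ℝ, wlH a (b - 1) (c + y * Complex.I) * Complex.exp (-t * (c + y * Complex.I : ℂ) ^ (b : ℂ))) := by
      refine wl_hs h3 (fun n => ?_) rfl
      field_simp
    rw [← h4.tsum_eq, wright, Complex.ofReal_tsum]
  · intro n
    exact ((wlH_cont hc _).const_mul _).aestronglyMeasurable
  · intro n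
    filter_upwards with y
    rw [wlH_mul_pow a b (b-1) (hv0 y), norm_mul, norm_mul, wlH_norm, norm_pow, Complex.norm_cpow_real, norm_div, norm_pow,
      norm_neg, Complex.norm_real, Real.norm_of_nonneg ht, Complex.norm_natCast, mul_pow]
    apply le_of_eq; ring
  · filter_upwards with y using (hbs y).summable
  · simp_rw [fun y => (hbs y).tsum_eq]
    obtain ⟨C, -, hC⟩ := wl_line ha ha2 hb0.le hba hc t (b - 1)
    refine (integrable_inv_one_add_sq.const_mul C).mono' (Continuous.aestronglyMeasurable ?_) ?_
    · have h1 := wl_cont_cpow hc a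
      have h2 : Continuous fun y : ℝ => ‖(c + y * Complex.I : ℂ)‖ ^ (b - 1) :=
        Continuous.rpow_const (by fun_prop) fun y => Or.inl (norm_ne_zero_iff.2 (hv0 y))
      have h3 : Continuous fun y : ℝ => ‖(c + y * Complex.I : ℂ)‖ ^ b :=
        Continuous.rpow_const (by fun_prop) fun y => Or.inl (norm_ne_zero_iff.2 (hv0 y))
      fun_prop
    · filter_upwards with y
      rw [Real.norm_of_nonneg (by positivity)]
      refine le_trans (le_of_eq ?_) (hC y)
      rw [Real.exp_add]; ring
  · filter_upwards with y
    have := (wl_cexp_hasSum (-t * (c + y * Complex.I : ℂ) ^ (b : ℂ))).mul_left (wlH a (b - 1) (c + y * Complex.I))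
    refine wl_hs this (fun n => ?_) rfl
    rw [wlH_mul_pow a b (b-1) (hv0 y), mul_pow]
    ring

lemma wl_re_ge {b c : ℝ} (hb : 0 < b) (hb1 : b < 1) (hc : 0 < c) (y : ℝ) :
    Real.cos (b * (Real.pi / 2)) * c ^ b ≤ ((c + y * Complex.I : ℂ) ^ (b:ℂ)).re := by
  set v : ℂ := c + y * Complex.I with hv
  have hpi := Real.pi_pos
  have hre : v.re = c := by simp [hv]
  have harg : |v.arg| ≤ Real.pi / 2 := Complex.abs_arg_le_pi_div_two_iff.2 (by rw [hre]; exact hc.le)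
  have hn : c ≤ ‖v‖ := by
    have := (le_abs_self _).trans (Complex.abs_re_le_norm v)
    rwa [hre] at this
  rw [Complex.cpow_ofReal_re, mul_comm]
  have hcos : 0 ≤ Real.cos (b * (Real.pi / 2)) := Real.cos_nonneg_of_neg_pi_div_two_le_of_le (by nlinarith) (by nlinarith)
  have h2 : Real.cos (b * (Real.pi / 2)) ≤ Real.cos (v.arg * b) := by
    rw [← Real.cos_abs (v.arg * b), abs_mul, abs_of_pos hb, mul_comm |v.arg|]
    exact Real.cos_le_cos_of_nonneg_of_le_pi (by positivity) (by nlinarith) (by gcongr)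
  gcongr

/-- For `γ ∈ (0,1)` and every `z ∈ ℂ`, `∫_0^∞ e^{-zt} Φ_γ(t) dt = E_γ(-z)`, where
`E_γ(w) = Σ_{n=0}^∞ w^n / Γ(1 + γn)` is the Mittag-Leffler function. -/
theorem wright_laplace_mittagLeffler (γ : ℝ) (hγ : γ ∈ Set.Ioo (0:ℝ) 1) (z : ℂ) :
    ∫ t in Set.Ioi (0:ℝ), Complex.exp (-z * t) * (wright γ t : ℂ) =
      ∑' n : ℕ, (-z) ^ n / Complex.Gamma (1 + (γ : ℂ) * n) := by
  obtain ⟨hγ0, hγ1⟩ := hγ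
  have hpi := Real.pi_pos
  obtain ⟨a, ha, ha'⟩ := exists_between (show (1:ℝ) < min 2 (1 / γ) from lt_min (by norm_num) (by rw [lt_div_iff₀ hγ0]; linarith))
  have ha2 : a < 2 := ha'.trans_le (min_le_left _ _)
  have hb1 : a * γ < 1 := by
    have := ha'.trans_le (min_le_right _ _)
    rwa [lt_div_iff₀ hγ0] at this
  have ha0 : (a:ℂ) ≠ 0 := by exact_mod_cast (by linarith : a ≠ 0)
  have hpi0 : (Real.pi : ℂ) ≠ 0 := by exact_mod_cast Real.pi_ne_zero
  obtain ⟨b, hb⟩ : ∃ b, b = a * γ := ⟨_, rfl⟩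
  rw [← hb] at hb1
  have hb0 : 0 < b := by rw [hb]; positivity
  have hd : 0 < Real.cos (b * (Real.pi / 2)) := Real.cos_pos_of_mem_Ioo ⟨by nlinarith, by nlinarith⟩
  set d := Real.cos (b * (Real.pi / 2)) with hdd
  have hd1 : d ≤ 1 := Real.cos_le_one _
  set c : ℝ := ((‖z‖ + 1) / d) ^ (1 / b) with hcd
  have hzp : 0 < ‖z‖ + 1 := by positivity
  have hc : 0 < c := by rw [hcd]; positivity
  have hcb : d * c ^ b = ‖z‖ + 1 := by
    rw [hcd, ← Real.rpow_mul (by positivity), one_div_mul_cancel hb0.ne', Real.rpow_one]; field_simp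
  have hW (y : ℝ) : ‖z‖ + 1 ≤ ((c + y * Complex.I : ℂ) ^ (b:ℂ)).re := by
    rw [← hcb]; exact wl_re_ge hb0 hb1 hc y
  have hWn (y : ℝ) : ‖z‖ + 1 ≤ ‖(c + y * Complex.I : ℂ) ^ (b:ℂ)‖ := (hW y).trans (Complex.re_le_norm _)
  have hWc := wl_cont_cpow hc b
  have hv0 (y : ℝ) : (c + y * Complex.I : ℂ) ≠ 0 := Complex.slitPlane_ne_zero (wl_slit hc y)
  have hHc := wlH_cont (a := a) hc (b - 1)
  have hHi := wlH_integrable ha ha2 hc (b - 1)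
  -- Fubini
  have hprod : Integrable (Function.uncurry fun (t y : ℝ) => Complex.exp (-z * t) *
      (wlH a (b - 1) (c + y * Complex.I) * Complex.exp (-t * (c + y * Complex.I : ℂ) ^ (b : ℂ))))
      ((volume.restrict (Set.Ioi (0:ℝ))).prod volume) := by
    have hexp : Integrable (fun t : ℝ => Real.exp (-t)) (volume.restrict (Set.Ioi (0:ℝ))) := integrableOn_exp_neg_Ioi 0
    refine (hexp.mul_prod hHi.norm).mono' (Continuous.aestronglyMeasurable ?_) ?_
    · have h1 : Continuous fun x : ℝ × ℝ => wlH a (b - 1) (c + x.2 * Complex.I) := hHc.comp continuous_snd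
      have h2 : Continuous fun x : ℝ × ℝ => (c + x.2 * Complex.I : ℂ) ^ (b:ℂ) := hWc.comp continuous_snd
      simp only [Function.uncurry_def]
      fun_prop
    · have hmem : ∀ᵐ x : ℝ × ℝ ∂((volume.restrict (Set.Ioi (0:ℝ))).prod volume), x.1 ∈ Set.Ioi (0:ℝ) := by
        exact Measure.quasiMeasurePreserving_fst.ae (ae_restrict_mem measurableSet_Ioi)
      filter_upwards [hmem] with x hx
      have hx : 0 < x.1 := hx
      simp only [Function.uncurry_def]
      rw [norm_mul, norm_mul, Complex.norm_exp, Complex.norm_exp]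
      have e1 : (-z * (x.1:ℂ)).re + (-(x.1:ℂ) * (c + x.2 * Complex.I : ℂ) ^ (b : ℂ)).re ≤ -x.1 := by
        have h1 := hW x.2
        have h2 : -z.re ≤ ‖z‖ := (neg_le_abs _).trans (Complex.abs_re_le_norm z)
        rw [← Complex.ofReal_neg, Complex.re_ofReal_mul, Complex.re_mul_ofReal, Complex.neg_re]
        nlinarith
      calc _ = Real.exp ((-z * (x.1:ℂ)).re + (-(x.1:ℂ) * (c + x.2 * Complex.I : ℂ) ^ (b : ℂ)).re) * ‖wlH a (b - 1) (c + x.2 * Complex.I)‖ := by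
            rw [Real.exp_add]; ring
        _ ≤ _ := by gcongr
  have step1 : ∫ t in Set.Ioi (0:ℝ), Complex.exp (-z * t) * (wright γ t : ℂ) =
      (a / (2 * Real.pi)) * ∫ t in Set.Ioi (0:ℝ), ∫ y : ℝ, Complex.exp (-z * t) *
      (wlH a (b - 1) (c + y * Complex.I) * Complex.exp (-t * (c + y * Complex.I : ℂ) ^ (b : ℂ))) := by
    rw [← integral_const_mul]
    refine setIntegral_congr_fun measurableSet_Ioi fun t ht => ?_
    have ht : 0 < t := ht
    rw [wl_wright_rep ha ha2 hγ0 hγ1 hc ht.le, integral_const_mul, ← hb]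
    ring
  have step2 (y : ℝ) : ∫ t in Set.Ioi (0:ℝ), Complex.exp (-z * t) *
      (wlH a (b - 1) (c + y * Complex.I) * Complex.exp (-t * (c + y * Complex.I : ℂ) ^ (b : ℂ)))
      = wlH a (b - 1) (c + y * Complex.I) * (z + (c + y * Complex.I : ℂ) ^ (b : ℂ))⁻¹ := by
    have hre : (-(z + (c + y * Complex.I : ℂ) ^ (b : ℂ))).re < 0 := by
      have h2 : -z.re ≤ ‖z‖ := (neg_le_abs _).trans (Complex.abs_re_le_norm z)
      have := hW y
      rw [Complex.neg_re, Complex.add_re]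
      linarith
    have h := integral_exp_mul_complex_Ioi hre 0
    have e : ∀ t : ℝ, Complex.exp (-z * t) *
      (wlH a (b - 1) (c + y * Complex.I) * Complex.exp (-t * (c + y * Complex.I : ℂ) ^ (b : ℂ))) =
      wlH a (b - 1) (c + y * Complex.I) * Complex.exp (-(z + (c + y * Complex.I : ℂ) ^ (b : ℂ)) * t) := by
      intro t
      rw [mul_left_comm, ← Complex.exp_add]; congr 2; ring
    simp_rw [e]
    rw [integral_const_mul, h]
    congr 1
    simp only [Complex.ofReal_zero, mul_zero, Complex.exp_zero, neg_div_neg_eq, one_div]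
  rw [step1, integral_integral_swap hprod]
  simp_rw [step2]
  -- geometric series
  set ρ : ℝ := ‖z‖ / (‖z‖ + 1) with hρ
  have hρ0 : 0 ≤ ρ := by positivity
  have hρ1 : ρ < 1 := by rw [hρ, div_lt_one hzp]; linarith
  have hterm (n : ℕ) (y : ℝ) : wlH a (-b * n + (-1)) (c + y * Complex.I) =
      wlH a (-1) (c + y * Complex.I) * (((c + y * Complex.I : ℂ) ^ (b:ℂ))⁻¹) ^ n := by
    rw [wlH_mul_pow a (-b) (-1) (hv0 y)]
    congr 2
    rw [Complex.ofReal_neg, Complex.cpow_neg]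
  have key := hasSum_integral_of_dominated_convergence (μ := (volume : Measure ℝ))
    (F := fun (n : ℕ) (y : ℝ) => (-z) ^ n * wlH a (-b * n + (-1)) (c + y * Complex.I))
    (f := fun y => wlH a (b - 1) (c + y * Complex.I) * (z + (c + y * Complex.I : ℂ) ^ (b : ℂ))⁻¹)
    (fun n y => ‖wlH a (-1) (c + y * Complex.I)‖ * ρ ^ n) ?_ ?_ ?_ ?_ ?_
  · have h3 := key.mul_left ((a:ℂ) / (2 * Real.pi))
    rw [← h3.tsum_eq]
    refine tsum_congr fun n => ?_
    rw [integral_const_mul]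
    change _ * (_ * wlJ a c (-b * n + (-1))) = _
    rw [wlJ_eq ha ha2 hc]
    have e : (1 - (((-b * n + (-1) : ℝ):ℂ) + 1) / a) = 1 + (γ:ℂ) * n := by
      rw [hb]; push_cast; field_simp; ring
    rw [e, div_eq_mul_inv ((-z) ^ n)]
    field_simp
  · intro n
    exact ((wlH_cont hc _).const_mul _).aestronglyMeasurable
  · intro n
    filter_upwards with y
    rw [hterm, norm_mul, norm_mul, norm_pow, norm_neg, norm_pow, norm_inv, mul_left_comm, ← mul_pow]
    gcongr
    rw [hρ, ← div_eq_mul_inv]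
    gcongr
    exact hWn y
  · filter_upwards with y using (summable_geometric_of_lt_one hρ0 hρ1).mul_left _
  · simp_rw [tsum_mul_left]
    exact (wlH_integrable ha ha2 hc (-1)).norm.mul_const _
  · filter_upwards with y
    set W : ℂ := (c + y * Complex.I : ℂ) ^ (b : ℂ) with hWd
    have hWpos : 0 < ‖W‖ := hzp.trans_le (hWn y)
    have hW0 : W ≠ 0 := norm_pos_iff.1 hWpos
    have hlt : ‖-z * W⁻¹‖ < 1 := by
      rw [norm_mul, norm_neg, norm_inv, ← div_eq_mul_inv, div_lt_one hWpos]
      have := hWn y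
      linarith
    have := (hasSum_geometric_of_norm_lt_one hlt).mul_left (wlH a (-1) (c + y * Complex.I))
    refine wl_hs this (fun n => ?_) ?_
    · rw [hterm, mul_pow]; ring
    · have e := wlH_mul_pow a b (-1) (hv0 y) 1
      have e' : b * ((1:ℕ):ℝ) + -1 = b - 1 := by push_cast; ring
      rw [e', pow_one, ← hWd] at e
      rw [e]
      have h1 : 1 - -z * W⁻¹ = (z + W) * W⁻¹ := by field_simp; ring
      rw [h1, mul_inv, inv_inv]; ring
end

section
/- Let γ ∈ (0,1), β ∈ (0,1], M₀, c > 0, and let (T(t))_{t>0} be a strongly continuous family of bounded operators on X with ‖T(t)‖ ≤ M₀ e^{−ct} t^{β−1} for all t > 0. Define S_γ(t)x = ∫_0^∞ Φ_γ(s) T(s t^γ) x ds for t > 0. Then there is a constant M₁ > 0 such that ‖S_γ(t)‖ ≤ M₁ t^{γ(β−1)} for all t > 0, and moreover there is M₂ > 0 such that ‖S_γ(t)‖ ≤ M₂ t^{−γ} for all t ≥ 1. -/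
open MeasureTheory

lemma norm_cexp_sub_one_le_of_re_nonpos {z : ℂ} (hz : z.re ≤ 0) : ‖Complex.exp z - 1‖ ≤ ‖z‖ := by
  have h := Convex.norm_image_sub_le_of_norm_hasDerivWithin_le (𝕜 := ℂ) (f := Complex.exp)
    (f' := Complex.exp) (s := {w : ℂ | w.re ≤ 0}) (x := 0) (y := z) (C := 1)
    (fun w _ => (Complex.hasDerivAt_exp w).hasDerivWithinAt)
    (fun w hw => by
      rw [Complex.norm_exp]
      exact Real.exp_le_one_iff.mpr hw)
    (convex_halfSpace_re_le 0) (by simp) hz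
  simpa using h

lemma aesm_aux (a : ℝ) (r : ℂ) : AEStronglyMeasurable
    (fun u : ℝ => ((u ^ (a - 1) : ℝ) : ℂ) * Complex.exp (-(r * u)))
    (volume.restrict (Set.Ioi 0)) := by
  apply Measurable.aestronglyMeasurable
  fun_prop

lemma integrable_real_aux {a d : ℝ} (ha : 0 < a) (hd : 0 < d) :
    IntegrableOn (fun u : ℝ => u ^ (a - 1) * Real.exp (-(d * u))) (Set.Ioi 0) := by
  have h := integrableOn_rpow_mul_exp_neg_mul_rpow (p := 1) (s := a - 1) (b := d)
    (by linarith) one_pos hd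
  simpa using h

lemma norm_aux {u : ℝ} (hu : 0 < u) (a : ℝ) (r : ℂ) :
    ‖((u ^ (a - 1) : ℝ) : ℂ) * Complex.exp (-(r * u))‖
      = u ^ (a - 1) * Real.exp (-(r.re * u)) := by
  rw [norm_mul, Complex.norm_real, Complex.norm_exp, Real.norm_of_nonneg (by positivity)]
  simp

lemma integrable_aux {a : ℝ} {r : ℂ} (ha : 0 < a) (hr : 0 < r.re) :
    IntegrableOn (fun u : ℝ => ((u ^ (a - 1) : ℝ) : ℂ) * Complex.exp (-(r * u))) (Set.Ioi 0) := by
  refine (integrable_real_aux ha hr).mono' (aesm_aux a r) ?_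
  filter_upwards [ae_restrict_mem measurableSet_Ioi] with u hu
  exact (norm_aux hu a r).le

lemma differentiableAt_laplace {a : ℝ} (ha : 0 < a) {r : ℂ} (hr : 0 < r.re) :
    DifferentiableAt ℂ (fun r : ℂ => ∫ u in Set.Ioi (0:ℝ),
      ((u ^ (a - 1) : ℝ) : ℂ) * Complex.exp (-(r * u))) r := by
  have hd : 0 < r.re / 2 := by linarith
  have key := hasDerivAt_integral_of_dominated_loc_of_deriv_le (𝕜 := ℂ)
    (μ := volume.restrict (Set.Ioi (0:ℝ)))
    (F := fun (r : ℂ) (u : ℝ) => ((u ^ (a - 1) : ℝ) : ℂ) * Complex.exp (-(r * u)))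
    (F' := fun (r : ℂ) (u : ℝ) => ((u ^ (a - 1) : ℝ) : ℂ) * (Complex.exp (-(r * u)) * (-u)))
    (x₀ := r) (s := {z : ℂ | r.re / 2 < z.re})
    (bound := fun u => u ^ ((a + 1) - 1) * Real.exp (-(r.re / 2 * u)))
    ((isOpen_lt continuous_const Complex.continuous_re).mem_nhds (by
      simp only [Set.mem_ofPred_eq]; linarith))
    (Filter.Eventually.of_forall fun z => aesm_aux a z)
    (integrable_aux ha hr)
    (by
      apply Measurable.aestronglyMeasurable
      fun_prop)
    (by
      filter_upwards [ae_restrict_mem measurableSet_Ioi] with u hu z hz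
      have hu : 0 < u := hu
      have hz : r.re / 2 < z.re := hz
      rw [← mul_assoc, norm_mul, norm_aux hu, norm_neg, Complex.norm_real,
        Real.norm_of_nonneg hu.le]
      have : u ^ (a + 1 - 1) = u ^ (a - 1) * u := by
        rw [← Real.rpow_add_one hu.ne']; ring_nf
      rw [this]
      have : Real.exp (-(z.re * u)) ≤ Real.exp (-(r.re / 2 * u)) := by
        apply Real.exp_le_exp.mpr
        nlinarith
      have h2 : 0 < u ^ (a - 1) := by positivity
      calc u ^ (a - 1) * Real.exp (-(z.re * u)) * u
          = u ^ (a - 1) * u * Real.exp (-(z.re * u)) := by ring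
        _ ≤ _ := by gcongr)
    (integrable_real_aux (by linarith) hd)
    (by
      filter_upwards with u z hz
      have h1 : HasDerivAt (fun z : ℂ => -(z * u)) (-(u:ℂ)) z := by
        have h0 := ((hasDerivAt_id z).mul_const (u:ℂ)).neg
        rw [one_mul] at h0
        exact h0
      exact (h1.cexp).const_mul _)
  exact key.2.differentiableAt

lemma laplace_real {a : ℝ} (ha : 0 < a) {r : ℝ} (hr : 0 < r) :
    ∫ u in Set.Ioi (0:ℝ), ((u ^ (a - 1) : ℝ) : ℂ) * Complex.exp (-((r:ℂ) * u))
      = (r:ℂ) ^ (-(a:ℂ)) * Real.Gamma a := by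
  have h := Real.integral_rpow_mul_exp_neg_mul_Ioi ha hr
  have h2 : ∀ u : ℝ, ((u ^ (a - 1) : ℝ) : ℂ) * Complex.exp (-((r:ℂ) * u))
      = ((u ^ (a - 1) * Real.exp (-(r * u)) : ℝ) : ℂ) := by
    intro u; push_cast; rfl
  simp_rw [h2]
  rw [integral_complex_ofReal, h, one_div, Real.inv_rpow hr.le, ← Real.rpow_neg hr.le]
  rw [Complex.ofReal_mul, Complex.ofReal_cpow hr.le]
  push_cast; rfl

lemma laplace_complex {a : ℝ} (ha : 0 < a) {r : ℂ} (hr : 0 < r.re) :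
    ∫ u in Set.Ioi (0:ℝ), ((u ^ (a - 1) : ℝ) : ℂ) * Complex.exp (-(r * u))
      = r ^ (-(a:ℂ)) * Real.Gamma a := by
  set U : Set ℂ := {z : ℂ | 0 < z.re} with hU
  have hUo : IsOpen U := isOpen_lt continuous_const Complex.continuous_re
  have hf : AnalyticOnNhd ℂ (fun r : ℂ => ∫ u in Set.Ioi (0:ℝ),
      ((u ^ (a - 1) : ℝ) : ℂ) * Complex.exp (-(r * u))) U :=
    DifferentiableOn.analyticOnNhd
      (fun z hz => (differentiableAt_laplace ha hz).differentiableWithinAt) hUo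
  have hg : AnalyticOnNhd ℂ (fun r : ℂ => r ^ (-(a:ℂ)) * (Real.Gamma a : ℂ)) U := by
    refine DifferentiableOn.analyticOnNhd (fun z hz => DifferentiableAt.differentiableWithinAt ?_) hUo
    refine DifferentiableAt.mul_const ?_ _
    exact DifferentiableAt.cpow_const differentiableAt_id (Or.inl hz)
  have hUc : IsPreconnected U := (convex_halfSpace_re_gt 0).isPreconnected
  refine hf.eqOn_of_preconnected_of_frequently_eq hg hUc (z₀ := 1) (by simp [hU]) ?_ hr
  have ht : Filter.Tendsto (fun n : ℕ => ((1 + 1 / ((n:ℝ) + 1) : ℝ) : ℂ)) Filter.atTop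
      (nhdsWithin 1 {1}ᶜ) := by
    refine tendsto_nhdsWithin_iff.mpr ⟨?_, Filter.Eventually.of_forall fun n => ?_⟩
    · have := (tendsto_one_div_add_atTop_nhds_zero_nat (𝕜 := ℝ)).const_add 1
      have h2 := (Complex.continuous_ofReal.tendsto _).comp this
      rw [add_zero, Complex.ofReal_one] at h2
      exact h2
    · simp only [Set.mem_compl_iff, Set.mem_singleton_iff]
      intro h
      have h1 : (1 + 1 / ((n:ℝ) + 1) : ℝ) = 1 := by exact_mod_cast h
      have h2 : 0 < 1 / ((n:ℝ) + 1) := by positivity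
      linarith
  refine ht.frequently (Filter.Eventually.frequently (Filter.Eventually.of_forall fun n => ?_))
  exact laplace_real ha (by positivity)

lemma rpow_le_linear {γ d s : ℝ} (hγ : γ ∈ Set.Ioo (0:ℝ) 1) (hd : 0 < d) (hs : 0 < s) :
    ∃ K : ℝ, ∀ u : ℝ, 0 < u → s * u ^ γ ≤ d * u + K := by
  obtain ⟨h0, h1⟩ := hγ
  set U : ℝ := (s / d) ^ (1 / (1 - γ)) with hU
  have hUpos : 0 < U := by positivity
  refine ⟨s * U ^ γ, fun u hu => ?_⟩
  rcases le_total u U with h | h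
  · have : u ^ γ ≤ U ^ γ := Real.rpow_le_rpow hu.le h h0.le
    have : s * u ^ γ ≤ s * U ^ γ := by gcongr
    nlinarith [mul_pos hd hu]
  · have h2 : U ^ (1 - γ) ≤ u ^ (1 - γ) := Real.rpow_le_rpow hUpos.le h (by linarith)
    have h3 : U ^ (1 - γ) = s / d := by
      rw [hU, ← Real.rpow_mul (by positivity), one_div, inv_mul_cancel₀ (by linarith),
        Real.rpow_one]
    rw [h3, div_le_iff₀ hd] at h2
    have h4 : u ^ (1 - γ) * u ^ γ = u := by
      rw [← Real.rpow_add hu]; simp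
    have h5 : 0 < u ^ γ := by positivity
    have h6 : 0 < s * U ^ γ := by positivity
    have : s * u ^ γ ≤ u ^ (1 - γ) * d * u ^ γ := by gcongr
    nlinarith

lemma integrable_growth {γ d s : ℝ} (hγ : γ ∈ Set.Ioo (0:ℝ) 1) (hd : 0 < d) (hs : 0 < s) :
    IntegrableOn (fun u : ℝ => u ^ (γ - 1) * Real.exp (-(d * u)) * Real.exp (s * u ^ γ))
      (Set.Ioi 0) := by
  obtain ⟨K, hK⟩ := rpow_le_linear hγ (half_pos hd) hs
  refine ((integrable_real_aux hγ.1 (half_pos hd)).mul_const (Real.exp K)).mono' ?_ ?_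
  · apply Measurable.aestronglyMeasurable
    fun_prop
  · filter_upwards [ae_restrict_mem measurableSet_Ioi] with u hu
    have hu : 0 < u := hu
    rw [Real.norm_of_nonneg (by positivity), mul_assoc, mul_assoc, ← Real.exp_add, ← Real.exp_add]
    refine mul_le_mul_of_nonneg_left (Real.exp_le_exp.mpr ?_) (by positivity)
    linarith [hK u hu]

lemma wright_rep {γ s ψ : ℝ} (hγ : γ ∈ Set.Ioo (0:ℝ) 1) (hs : 0 < s)
    (hψ1 : Real.pi / 2 < ψ) (hψ2 : ψ < Real.pi) {w r : ℂ}
    (hw : w = Complex.exp (((ψ * γ : ℝ) : ℂ) * Complex.I))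
    (hr : r = Complex.exp (((ψ - Real.pi : ℝ) : ℂ) * Complex.I)) (hr0 : 0 < r.re) :
    wright γ s = (1 / Real.pi) * (∫ u in Set.Ioi (0:ℝ),
      w * (((u ^ (γ - 1) : ℝ) : ℂ) * Complex.exp (-(r * u)))
        * Complex.exp (-(s * w * ((u ^ γ : ℝ) : ℂ)))).im := by
  have hnw : ‖w‖ = 1 := by rw [hw, Complex.norm_exp_ofReal_mul_I]
  have hmain := hasSum_integral_of_dominated_convergence (μ := volume.restrict (Set.Ioi (0:ℝ)))
    (F := fun (n : ℕ) (u : ℝ) => w * (((u ^ (γ - 1) : ℝ) : ℂ) * Complex.exp (-(r * u)))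
        * ((-(s * w * ((u ^ γ : ℝ) : ℂ))) ^ n / (n.factorial : ℂ)))
    (f := fun u : ℝ => w * (((u ^ (γ - 1) : ℝ) : ℂ) * Complex.exp (-(r * u)))
        * Complex.exp (-(s * w * ((u ^ γ : ℝ) : ℂ))))
    (fun (n : ℕ) (u : ℝ) => u ^ (γ - 1) * Real.exp (-(r.re * u)) * ((s * u ^ γ) ^ n / n.factorial))
    (fun n => by
      apply Measurable.aestronglyMeasurable
      fun_prop)
    (fun n => by
      filter_upwards [ae_restrict_mem measurableSet_Ioi] with u hu
      have hu : 0 < u := hu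
      rw [norm_mul, norm_mul, hnw, norm_aux hu, one_mul, norm_div, norm_pow, norm_neg, norm_mul,
        norm_mul, hnw, Complex.norm_real, Complex.norm_real, Complex.norm_natCast,
        Real.norm_of_nonneg hs.le, Real.norm_of_nonneg (by positivity), mul_one])
    (by
      filter_upwards with u
      exact (Real.summable_pow_div_factorial _).mul_left _)
    (by
      have h := integrable_growth hγ hr0 hs
      refine h.congr ?_
      filter_upwards with u
      rw [tsum_mul_left, Real.exp_eq_exp_ℝ, NormedSpace.exp_eq_tsum_div])
    (by
      filter_upwards with u
      refine HasSum.mul_left _ ?_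
      rw [Complex.exp_eq_exp_ℂ]
      exact NormedSpace.expSeries_div_hasSum_exp _)
  have him := (Complex.hasSum_iff _ _).1 hmain |>.2
  rw [← (him.mul_left (1 / Real.pi)).tsum_eq, wright]
  congr 1
  funext n
  set z : ℝ := γ * (n + 1) with hz
  have hzpos : 0 < z := by have := hγ.1; positivity
  have e1 : ∫ u in Set.Ioi (0:ℝ), w * (((u ^ (γ - 1) : ℝ) : ℂ) * Complex.exp (-(r * u)))
        * ((-(s * w * ((u ^ γ : ℝ) : ℂ))) ^ n / (n.factorial : ℂ))
      = (((-s) ^ n / n.factorial : ℝ) : ℂ) * (w ^ (n + 1) *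
          ∫ u in Set.Ioi (0:ℝ), ((u ^ (z - 1) : ℝ) : ℂ) * Complex.exp (-(r * u))) := by
    rw [← integral_const_mul, ← integral_const_mul]
    refine setIntegral_congr_fun measurableSet_Ioi fun u hu => ?_
    have hu : 0 < u := hu
    have : u ^ (z - 1) = u ^ (γ - 1) * (u ^ γ) ^ n := by
      rw [← Real.rpow_natCast, ← Real.rpow_mul hu.le, ← Real.rpow_add hu]
      congr 1
      rw [hz]; ring
    simp only [this]
    push_cast
    have : (-(s * w * ((u ^ γ : ℝ) : ℂ))) ^ n = (-(s:ℂ)) ^ n * w ^ n * ((u ^ γ : ℝ) : ℂ) ^ n := by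
      rw [← mul_pow, ← mul_pow]; ring
    rw [this]
    ring
  have e2 : w ^ (n + 1) * r ^ (-(z:ℂ)) = Complex.exp (((Real.pi * z : ℝ) : ℂ) * Complex.I) := by
    have hlog : Complex.log r = ((ψ - Real.pi : ℝ) : ℂ) * Complex.I := by
      rw [hr, Complex.log_exp]
      · simp; linarith [Real.pi_pos]
      · simp; linarith [Real.pi_pos]
    rw [Complex.cpow_def_of_ne_zero (by rw [hr]; exact Complex.exp_ne_zero _), hlog, hw,
      ← Complex.exp_nat_mul, ← Complex.exp_add]
    congr 1
    rw [hz]; push_cast; ring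
  rw [e1, laplace_complex hzpos hr0, ← mul_assoc (w ^ (n + 1)), e2, Complex.im_ofReal_mul,
    Complex.im_mul_ofReal, Complex.exp_ofReal_mul_I_im]
  have hrefl := Real.Gamma_mul_Gamma_one_sub z
  have hG : 0 < Real.Gamma z := Real.Gamma_pos_of_pos hzpos
  have e3 : 1 - γ - γ * n = 1 - z := by rw [hz]; ring
  rw [e3]
  have e4 : (Real.Gamma (1 - z))⁻¹ = Real.Gamma z * Real.sin (Real.pi * z) / Real.pi := by
    have h := congrArg (fun y => Real.Gamma z * y⁻¹) hrefl
    simp only [mul_inv, inv_div] at h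
    rw [mul_inv_cancel_left₀ hG.ne'] at h
    rw [h]; ring
  rw [div_mul_eq_div_div, div_eq_mul_inv _ (Real.Gamma (1 - z)), e4]
  ring

lemma wright_leading {γ s : ℝ} (hγ : 0 < γ) (hs : 0 < s) {w : ℂ} (hw : 0 < w.re) :
    (∫ u in Set.Ioi (0:ℝ), w * ((u ^ (γ - 1) : ℝ) : ℂ)
        * Complex.exp (-(s * w * ((u ^ γ : ℝ) : ℂ)))).im = 0 := by
  have hw0 : w ≠ 0 := by rintro rfl; simp at hw
  have hs0 : (s:ℂ) ≠ 0 := by exact_mod_cast hs.ne'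
  have h1 := integral_comp_rpow_Ioi (fun y : ℝ => Complex.exp (-(s * w) * (y:ℂ))) hγ.ne'
  rw [integral_exp_mul_complex_Ioi (by simp; positivity) 0] at h1
  have h2 : ∫ u in Set.Ioi (0:ℝ), w * ((u ^ (γ - 1) : ℝ) : ℂ)
        * Complex.exp (-(s * w * ((u ^ γ : ℝ) : ℂ)))
      = (w / γ) * ∫ x in Set.Ioi (0:ℝ),
        (|γ| * x ^ (γ - 1)) • Complex.exp (-(s * w) * ((x ^ γ : ℝ) : ℂ)) := by
    rw [← integral_const_mul]
    refine integral_congr_ae (Filter.Eventually.of_forall fun u => ?_)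
    have hg : (γ:ℂ) ≠ 0 := by exact_mod_cast hγ.ne'
    simp only [abs_of_pos hγ, Complex.real_smul, neg_mul]
    rw [Complex.ofReal_mul]
    field_simp
  rw [h2, h1]
  have h3 : w / (γ:ℂ) * (-Complex.exp (-(s * w) * ((0:ℝ):ℂ)) / (-(s * w)))
      = ((1 / (γ * s) : ℝ) : ℂ) := by
    simp only [Complex.ofReal_zero, mul_zero, Complex.exp_zero]
    push_cast
    have hg : (γ:ℂ) ≠ 0 := by exact_mod_cast hγ.ne'
    field_simp
  rw [h3, Complex.ofReal_im]

lemma wright_bound {γ : ℝ} (hγ : γ ∈ Set.Ioo (0:ℝ) 1) :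
    ∃ C > (0:ℝ), (∀ s > (0:ℝ), |wright γ s| ≤ C) ∧
      (∀ s ≥ (1:ℝ), |wright γ s| ≤ C * s ^ (-2:ℝ)) := by
  obtain ⟨hγ0, hγ1⟩ := hγ
  have hpi := Real.pi_pos
  obtain ⟨ψ, hψ1, hψ2⟩ : ∃ ψ, Real.pi / 2 < ψ ∧ ψ < min Real.pi (Real.pi / 2 / γ) := by
    apply exists_between
    refine lt_min (by linarith) ?_
    rw [lt_div_iff₀ hγ0]
    nlinarith
  obtain ⟨hψ2, hψ3⟩ := lt_min_iff.mp hψ2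
  rw [lt_div_iff₀ hγ0] at hψ3
  set w : ℂ := Complex.exp (((ψ * γ : ℝ) : ℂ) * Complex.I) with hw
  set r : ℂ := Complex.exp (((ψ - Real.pi : ℝ) : ℂ) * Complex.I) with hr
  have hnw : ‖w‖ = 1 := by rw [hw, Complex.norm_exp_ofReal_mul_I]
  have hnr : ‖r‖ = 1 := by rw [hr, Complex.norm_exp_ofReal_mul_I]
  have hψγ : 0 < ψ * γ := by
    have : 0 < ψ := by linarith
    positivity
  have hw0 : 0 < w.re := by
    rw [hw, Complex.exp_ofReal_mul_I_re]
    exact Real.cos_pos_of_mem_Ioo ⟨by linarith, hψ3⟩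
  have hr0 : 0 < r.re := by
    rw [hr, Complex.exp_ofReal_mul_I_re]
    exact Real.cos_pos_of_mem_Ioo ⟨by linarith, by linarith⟩
  clear_value w r
  set A : ℝ := ∫ u in Set.Ioi (0:ℝ), u ^ (γ - 1) * Real.exp (-(r.re * u)) with hA
  set B : ℝ := w.re ^ (-(γ + 1) / γ) * (1 / γ) * Real.Gamma ((γ + 1) / γ) with hB
  have hA0 : 0 ≤ A := by
    refine setIntegral_nonneg measurableSet_Ioi fun u hu => ?_
    have hu : 0 < u := hu
    positivity
  have hB0 : 0 < B := by
    have : 0 < Real.Gamma ((γ + 1) / γ) := Real.Gamma_pos_of_pos (by positivity)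
    positivity
  have hexp : ∀ s > (0:ℝ), ∀ u > (0:ℝ), ‖Complex.exp (-(s * w * ((u ^ γ : ℝ) : ℂ)))‖
      = Real.exp (-(s * w.re) * u ^ γ) := by
    intro s hs u hu
    rw [Complex.norm_exp]
    congr 1
    simp
  have hbd1 : ∀ s > (0:ℝ), ∀ u > (0:ℝ),
      ‖w * (((u ^ (γ - 1) : ℝ) : ℂ) * Complex.exp (-(r * u)))
        * Complex.exp (-(s * w * ((u ^ γ : ℝ) : ℂ)))‖ ≤ u ^ (γ - 1) * Real.exp (-(r.re * u)) := by
    intro s hs u hu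
    rw [norm_mul, norm_mul, hnw, norm_aux hu, one_mul, hexp s hs u hu]
    refine mul_le_of_le_one_right (by positivity) (Real.exp_le_one_iff.mpr ?_)
    have : 0 < s * w.re * u ^ γ := by positivity
    linarith
  have hmul : ∀ x y : ℝ, |x| ≤ y → |1 / Real.pi * x| ≤ y := by
    intro x y h
    rw [abs_mul, abs_of_pos (by positivity)]
    have : 1 / Real.pi ≤ 1 := by
      rw [div_le_one hpi]; linarith [Real.pi_gt_three]
    exact (mul_le_of_le_one_left (abs_nonneg x) this).trans h
  refine ⟨A + B, by linarith, fun s hs => ?_, fun s hs => ?_⟩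
  · rw [wright_rep ⟨hγ0, hγ1⟩ hs hψ1 hψ2 hw hr hr0]
    refine hmul _ _ ((Complex.abs_im_le_norm _).trans ?_)
    refine (norm_integral_le_of_norm_le (integrable_real_aux hγ0 hr0) ?_).trans
      (le_add_of_nonneg_right hB0.le)
    filter_upwards [ae_restrict_mem measurableSet_Ioi] with u hu
    exact hbd1 s hs u hu
  · have hs0 : 0 < s := by linarith
    rw [wright_rep ⟨hγ0, hγ1⟩ hs0 hψ1 hψ2 hw hr hr0]
    apply hmul
    have hint1 : IntegrableOn (fun u : ℝ => w * (((u ^ (γ - 1) : ℝ) : ℂ) * Complex.exp (-(r * u)))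
        * Complex.exp (-(s * w * ((u ^ γ : ℝ) : ℂ)))) (Set.Ioi 0) := by
      refine (integrable_real_aux hγ0 hr0).mono' ?_ ?_
      · apply Measurable.aestronglyMeasurable
        fun_prop
      · filter_upwards [ae_restrict_mem measurableSet_Ioi] with u hu
        exact hbd1 s hs0 u hu
    have hint2 : IntegrableOn (fun u : ℝ => w * ((u ^ (γ - 1) : ℝ) : ℂ)
        * Complex.exp (-(s * w * ((u ^ γ : ℝ) : ℂ)))) (Set.Ioi 0) := by
      refine (integrableOn_rpow_mul_exp_neg_mul_rpow (p := γ) (s := γ - 1) (b := s * w.re)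
        (by linarith) hγ0 (by positivity)).mono' ?_ ?_
      · apply Measurable.aestronglyMeasurable
        fun_prop
      · filter_upwards [ae_restrict_mem measurableSet_Ioi] with u hu
        have hu : 0 < u := hu
        rw [norm_mul, norm_mul, hnw, hexp s hs0 u hu, one_mul, Complex.norm_real,
          Real.norm_of_nonneg (by positivity)]
    have hlead := wright_leading hγ0 hs0 hw0
    have hsub := congrArg Complex.im (integral_sub hint1 hint2)
    rw [Complex.sub_im, hlead, sub_zero] at hsub
    rw [← hsub]
    refine (Complex.abs_im_le_norm _).trans ?_
    refine (norm_integral_le_of_norm_le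
      (integrableOn_rpow_mul_exp_neg_mul_rpow (p := γ) (s := γ) (b := s * w.re)
        (by linarith) hγ0 (by positivity)) ?_).trans ?_
    · filter_upwards [ae_restrict_mem measurableSet_Ioi] with u hu
      have hu : 0 < u := hu
      have e : w * (((u ^ (γ - 1) : ℝ) : ℂ) * Complex.exp (-(r * u)))
            * Complex.exp (-(s * w * ((u ^ γ : ℝ) : ℂ)))
          - w * ((u ^ (γ - 1) : ℝ) : ℂ) * Complex.exp (-(s * w * ((u ^ γ : ℝ) : ℂ)))
          = w * (((u ^ (γ - 1) : ℝ) : ℂ) * (Complex.exp (-(r * u)) - 1))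
            * Complex.exp (-(s * w * ((u ^ γ : ℝ) : ℂ))) := by ring
      rw [e, norm_mul, norm_mul, norm_mul, hnw, hexp s hs0 u hu, one_mul, Complex.norm_real,
          Real.norm_of_nonneg (by positivity)]
      have h1 : ‖Complex.exp (-(r * u)) - 1‖ ≤ u := by
        refine (norm_cexp_sub_one_le_of_re_nonpos ?_).trans ?_
        · have : 0 < r.re * u := by positivity
          simp; linarith
        · rw [norm_neg, norm_mul, hnr, one_mul, Complex.norm_real, Real.norm_of_nonneg hu.le]
      have h2 : u ^ γ = u ^ (γ - 1) * u := by
        rw [← Real.rpow_add_one hu.ne']; ring_nf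
      have h3 : u ^ (γ - 1) * ‖Complex.exp (-(r * u)) - 1‖ ≤ u ^ γ := by
        rw [h2]; gcongr
      gcongr
    · rw [integral_rpow_mul_exp_neg_mul_rpow hγ0 (by linarith) (by positivity),
        Real.mul_rpow hs0.le hw0.le]
      have h1 : s ^ (-(γ + 1) / γ) ≤ s ^ (-2:ℝ) := by
        apply Real.rpow_le_rpow_of_exponent_le hs
        rw [div_le_iff₀ hγ0]; linarith
      have h2 : 0 < s ^ (-2:ℝ) := by positivity
      calc s ^ (-(γ + 1) / γ) * w.re ^ (-(γ + 1) / γ) * (1 / γ) * Real.Gamma ((γ + 1) / γ)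
          = B * s ^ (-(γ + 1) / γ) := by rw [hB]; ring
        _ ≤ B * s ^ (-2:ℝ) := by gcongr
        _ ≤ (A + B) * s ^ (-2:ℝ) := by gcongr; linarith

lemma dominating_integrable {β : ℝ} (hβ : β ∈ Set.Ioc (0:ℝ) 1) :
    IntegrableOn (fun s : ℝ => if s ≤ 1 then s ^ (β - 1) else s ^ (-2:ℝ)) (Set.Ioi 0) := by
  rw [← Set.Ioc_union_Ioi_eq_Ioi (zero_le_one (α := ℝ))]
  refine IntegrableOn.union ?_ ?_
  · have h := (intervalIntegral.intervalIntegrable_rpow' (a := 0) (b := 1) (r := β - 1)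
      (by linarith [hβ.1]))
    rw [intervalIntegrable_iff_integrableOn_Ioc_of_le zero_le_one] at h
    refine h.congr_fun (fun s hs => ?_) measurableSet_Ioc
    simp [hs.2]
  · refine (integrableOn_Ioi_rpow_of_lt (a := -2) (by norm_num) one_pos).congr_fun
      (fun s hs => ?_) measurableSet_Ioi
    have hs : 1 < s := hs
    simp [not_le.mpr hs]


/-- If `‖T(t)‖ ≤ M₀ e^{-ct} t^{β-1}` for `t > 0`, and
`S_γ(t)x = ∫_0^∞ Φ_γ(s) T(s t^γ) x ds`, then `‖S_γ(t)‖ ≤ M₁ t^{γ(β-1)}` for all `t > 0`,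
and `‖S_γ(t)‖ ≤ M₂ t^{-γ}` for `t ≥ 1`. -/
theorem Sgamma_estimates {X : Type*} [NormedAddCommGroup X] [NormedSpace ℝ X] [CompleteSpace X]
    (γ β c M₀ : ℝ) (hγ : γ ∈ Set.Ioo (0:ℝ) 1) (hβ : β ∈ Set.Ioc (0:ℝ) 1)
    (hc : 0 < c) (hM₀ : 0 < M₀)
    (T : ℝ → X →L[ℝ] X)
    (hTcont : ∀ x : X, ContinuousOn (fun t => T t x) (Set.Ioi 0))
    (hT : ∀ t > (0:ℝ), ‖T t‖ ≤ M₀ * Real.exp (-c * t) * t ^ (β - 1)) :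
    (∃ M₁ > (0:ℝ), ∀ t > (0:ℝ), ∀ x : X,
      ‖∫ s in Set.Ioi (0:ℝ), wright γ s • T (s * t ^ γ) x‖ ≤ M₁ * t ^ (γ * (β - 1)) * ‖x‖) ∧
    (∃ M₂ > (0:ℝ), ∀ t ≥ (1:ℝ), ∀ x : X,
      ‖∫ s in Set.Ioi (0:ℝ), wright γ s • T (s * t ^ γ) x‖ ≤ M₂ * t ^ (-γ) * ‖x‖) := by
  obtain ⟨C, hC, hC1, hC2⟩ := wright_bound hγ
  have hγ0 := hγ.1
  have hβ0 := hβ.1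
  have hTx : ∀ t > (0:ℝ), ∀ s > (0:ℝ), ∀ x : X, ‖wright γ s • T (s * t ^ γ) x‖ ≤
      |wright γ s| * (M₀ * Real.exp (-(c * t ^ γ * s)) * (s ^ (β - 1) * t ^ (γ * (β - 1))))
        * ‖x‖ := by
    intro t ht s hs x
    have h1 := hT (s * t ^ γ) (by positivity)
    rw [Real.mul_rpow hs.le (by positivity), ← Real.rpow_mul ht.le,
      show -c * (s * t ^ γ) = -(c * t ^ γ * s) by ring] at h1
    rw [norm_smul, Real.norm_eq_abs, mul_assoc]
    refine mul_le_mul_of_nonneg_left ?_ (abs_nonneg _)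
    exact (T _).le_of_opNorm_le h1 x
  refine ⟨?_, ?_⟩
  · set D : ℝ := ∫ s in Set.Ioi (0:ℝ), (if s ≤ 1 then s ^ (β - 1) else s ^ (-2:ℝ)) with hD
    have hD0 : 0 ≤ D := by
      refine setIntegral_nonneg measurableSet_Ioi fun u hu => ?_
      have hu : 0 < u := hu
      split_ifs <;> positivity
    refine ⟨C * M₀ * (D + 1), by positivity, fun t ht x => ?_⟩
    have hi := (dominating_integrable hβ).const_mul (C * M₀ * t ^ (γ * (β - 1)) * ‖x‖)
    refine (norm_integral_le_of_norm_le hi ?_).trans ?_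
    · filter_upwards [ae_restrict_mem measurableSet_Ioi] with s hs
      have hs : 0 < s := hs
      refine (hTx t ht s hs x).trans ?_
      have hE : Real.exp (-(c * t ^ γ * s)) ≤ 1 := by
        apply Real.exp_le_one_iff.mpr
        have : 0 < c * t ^ γ * s := by positivity
        linarith
      have hE0 := Real.exp_pos (-(c * t ^ γ * s))
      have hw : |wright γ s| * s ^ (β - 1) ≤ C * (if s ≤ 1 then s ^ (β - 1) else s ^ (-2:ℝ)) := by
        split_ifs with h
        · have := hC1 s hs
          gcongr
        · have h1 : 1 ≤ s := (not_le.mp h).le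
          have h2 := hC2 s h1
          have h3 : s ^ (β - 1) ≤ 1 := Real.rpow_le_one_of_one_le_of_nonpos h1 (by linarith [hβ.2])
          exact (mul_le_of_le_one_right (abs_nonneg _) h3).trans h2
      have hw0 : 0 ≤ |wright γ s| * s ^ (β - 1) := by positivity
      calc |wright γ s| * (M₀ * Real.exp (-(c * t ^ γ * s)) * (s ^ (β - 1) * t ^ (γ * (β - 1))))
            * ‖x‖
          = (M₀ * t ^ (γ * (β - 1)) * ‖x‖) * (|wright γ s| * s ^ (β - 1))
            * Real.exp (-(c * t ^ γ * s)) := by ring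
        _ ≤ (M₀ * t ^ (γ * (β - 1)) * ‖x‖) * (|wright γ s| * s ^ (β - 1)) :=
            mul_le_of_le_one_right (by positivity) hE
        _ ≤ (M₀ * t ^ (γ * (β - 1)) * ‖x‖)
              * (C * (if s ≤ 1 then s ^ (β - 1) else s ^ (-2:ℝ))) := by gcongr
        _ = _ := by ring
    · rw [integral_const_mul, ← hD]
      have h0 : 0 ≤ C * M₀ * t ^ (γ * (β - 1)) * ‖x‖ := by positivity
      nlinarith
  · have hG : 0 < Real.Gamma β := Real.Gamma_pos_of_pos hβ0
    refine ⟨C * M₀ * ((1 / c) ^ β * Real.Gamma β), by positivity, fun t ht1 x => ?_⟩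
    have ht : 0 < t := by linarith
    have hct : 0 < c * t ^ γ := by positivity
    have hi := (integrable_real_aux hβ0 hct).const_mul (C * M₀ * t ^ (γ * (β - 1)) * ‖x‖)
    refine (norm_integral_le_of_norm_le hi ?_).trans ?_
    · filter_upwards [ae_restrict_mem measurableSet_Ioi] with s hs
      have hs : 0 < s := hs
      refine (hTx t ht s hs x).trans ?_
      have := hC1 s hs
      calc |wright γ s| * (M₀ * Real.exp (-(c * t ^ γ * s)) * (s ^ (β - 1) * t ^ (γ * (β - 1))))
            * ‖x‖
          ≤ C * (M₀ * Real.exp (-(c * t ^ γ * s)) * (s ^ (β - 1) * t ^ (γ * (β - 1))))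
            * ‖x‖ := by gcongr
        _ = _ := by ring
    · rw [integral_const_mul, Real.integral_rpow_mul_exp_neg_mul_Ioi hβ0 hct]
      have e1 : (1 / (c * t ^ γ)) ^ β = (1 / c) ^ β * t ^ (-(γ * β)) := by
        rw [one_div, mul_inv, Real.mul_rpow (by positivity) (by positivity), one_div,
          ← Real.rpow_neg ht.le, ← Real.rpow_mul ht.le]
        ring_nf
      have e2 : t ^ (-γ) = t ^ (γ * (β - 1)) * t ^ (-(γ * β)) := by
        rw [← Real.rpow_add ht]; ring_nf
      rw [e1, e2]
      apply le_of_eq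
      ring
end

section
/- Let γ ∈ (0,1), β ∈ (0,1], M₀, c > 0, and let (T(t))_{t>0} satisfy ‖T(t)‖ ≤ M₀ e^{−ct} t^{β−1} for t > 0. Define P_γ(t)x = γ ∫_0^∞ s Φ_γ(s) T(s t^γ) x ds. Then there exists M₂ > 0 such that ‖P_γ(t)‖ ≤ M₂ t^{−2γ} for all t ≥ 1. -/
open MeasureTheory

lemma aux_integrable {a b : ℝ} (ha : 0 < a) (hb : 0 < b) :
    Integrable (fun r : ℝ => r ^ (a - 1) * Real.exp (-(b * r))) (volume.restrict (Set.Ioi 0)) := by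
  have := integrableOn_rpow_mul_exp_neg_mul_rpow (p := 1) (s := a - 1) (by linarith) one_pos hb
  simpa [IntegrableOn] using this

lemma aux_norm {a : ℝ} (w : ℂ) {r : ℝ} (hr : 0 < r) :
    ‖((r ^ (a - 1) : ℝ) : ℂ) * Complex.exp (-(w * r))‖ = r ^ (a - 1) * Real.exp (-(w.re * r)) := by
  rw [norm_mul, Complex.norm_exp, Complex.norm_real, Real.norm_of_nonneg (by positivity)]
  simp

lemma aux_meas (a : ℝ) (w : ℂ) : Measurable
    (fun r : ℝ => ((r ^ (a - 1) : ℝ) : ℂ) * Complex.exp (-(w * r))) := by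
  fun_prop

lemma aux_int {a : ℝ} (ha : 0 < a) {w : ℂ} (hw : 0 < w.re) : Integrable
    (fun r : ℝ => ((r ^ (a - 1) : ℝ) : ℂ) * Complex.exp (-(w * r)))
      (volume.restrict (Set.Ioi 0)) := by
  refine (aux_integrable ha hw).mono' (aux_meas a w).aestronglyMeasurable ?_
  filter_upwards [ae_restrict_mem measurableSet_Ioi] with r hr
  exact (aux_norm w hr).le

lemma aux_diff {a : ℝ} (ha : 0 < a) : DifferentiableOn ℂ
    (fun w : ℂ => ∫ r in Set.Ioi (0:ℝ), ((r ^ (a - 1) : ℝ) : ℂ) * Complex.exp (-(w * r)))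
    {w | 0 < w.re} := by
  intro w₀ hw₀
  simp only [Set.mem_ofPred_eq] at hw₀
  apply DifferentiableAt.differentiableWithinAt
  have hs : {w : ℂ | w₀.re / 2 < w.re} ∈ nhds w₀ :=
    (isOpen_lt continuous_const Complex.continuous_re).mem_nhds (by simp; linarith)
  refine (hasDerivAt_integral_of_dominated_loc_of_deriv_le
    (F' := fun w r => ((r ^ (a - 1) : ℝ) : ℂ) * (Complex.exp (-(w * r)) * (-r)))
    (bound := fun r => r ^ ((a + 1) - 1) * Real.exp (-(w₀.re / 2 * r))) hs
    (Filter.Eventually.of_forall fun w => (aux_meas a w).aestronglyMeasurable) (aux_int ha hw₀)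
    ?_ ?_ (aux_integrable (by linarith) (by linarith)) ?_).2.differentiableAt
  · exact Measurable.aestronglyMeasurable (by fun_prop)
  · filter_upwards [ae_restrict_mem measurableSet_Ioi] with r hr w hw
    simp only [Set.mem_Ioi, Set.mem_ofPred_eq] at hr hw
    rw [← mul_assoc, norm_mul, aux_norm w hr, norm_neg, Complex.norm_real, Real.norm_of_nonneg hr.le,
      show a + 1 - 1 = (a - 1) + 1 by ring, Real.rpow_add_one hr.ne', mul_right_comm]
    gcongr
  · filter_upwards [ae_restrict_mem measurableSet_Ioi] with r hr w hw
    have h1 : HasDerivAt (fun w : ℂ => -(w * (r:ℂ))) (-r) w := by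
      have := ((hasDerivAt_id w).mul_const (r:ℂ)).neg
      rw [one_mul] at this
      exact this
    exact (h1.cexp).const_mul _

lemma aux_gamma {a : ℝ} (ha : 0 < a) {w : ℂ} (hw : 0 < w.re) :
    ∫ r in Set.Ioi (0:ℝ), ((r ^ (a - 1) : ℝ) : ℂ) * Complex.exp (-(w * r))
      = w ^ (-(a:ℂ)) * Real.Gamma a := by
  have hopen : IsOpen {w : ℂ | 0 < w.re} := isOpen_lt continuous_const Complex.continuous_re
  have h1 := (aux_diff ha).analyticOnNhd hopen
  have h2 : AnalyticOnNhd ℂ (fun w : ℂ => w ^ (-(a:ℂ)) * Real.Gamma a) {w | 0 < w.re} := by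
    refine DifferentiableOn.analyticOnNhd ?_ hopen
    intro z hz
    apply DifferentiableAt.differentiableWithinAt
    refine DifferentiableAt.mul_const ?_ _
    exact DifferentiableAt.cpow_const differentiableAt_id (Or.inl hz)
  refine h1.eqOn_of_preconnected_of_frequently_eq h2
    (convex_halfSpace_re_gt 0).isPreconnected (z₀ := 1) (by simp) ?_ hw
  have key : ∀ x : ℝ, 0 < x →
      ∫ r in Set.Ioi (0:ℝ), ((r ^ (a - 1) : ℝ) : ℂ) * Complex.exp (-((x:ℂ) * r))
      = (x:ℂ) ^ (-(a:ℂ)) * Real.Gamma a := by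
    intro x hx
    have := Real.integral_rpow_mul_exp_neg_mul_Ioi ha hx
    rw [one_div, Real.inv_rpow hx.le, ← Real.rpow_neg hx.le] at this
    rw [← Complex.ofReal_neg, ← Complex.ofReal_cpow hx.le, ← Complex.ofReal_mul, ← this,
      ← integral_complex_ofReal]
    push_cast
    rfl
  have ht : Filter.Tendsto (fun n : ℕ => ((1 + 1 / ((n:ℝ) + 1) : ℝ) : ℂ)) Filter.atTop
      (nhdsWithin 1 {1}ᶜ) := by
    rw [tendsto_nhdsWithin_iff]
    constructor
    · have := (tendsto_one_div_add_atTop_nhds_zero_nat (𝕜 := ℝ)).const_add 1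
      have := (Complex.continuous_ofReal.tendsto _).comp this
      rw [add_zero, Complex.ofReal_one] at this
      exact this
    · filter_upwards with n
      simp only [Set.mem_compl_iff, Set.mem_singleton_iff]
      norm_cast
      have : (0:ℝ) < 1 / ((n:ℝ) + 1) := by positivity
      intro h
      have h' : (1:ℝ) + 1 / ((n:ℝ) + 1) = 1 := by exact_mod_cast h
      linarith
  refine ht.frequently (Filter.Eventually.frequently (Filter.Eventually.of_forall fun n => ?_))
  exact key _ (by positivity)

/-- exponential domination -/
lemma aux_young {γ s κ : ℝ} (h0 : 0 < γ) (h1 : γ < 1) (hs : 0 ≤ s) (hκ : 0 < κ) :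
    ∃ K : ℝ, ∀ r : ℝ, 0 < r → s * r ^ γ ≤ K + κ * r := by
  have ht := (tendsto_rpow_neg_atTop (y := 1 - γ) (by linarith)).const_mul s
  rw [mul_zero] at ht
  obtain ⟨A, hA, hA0⟩ := ((ht.eventually (gt_mem_nhds hκ)).and (Filter.eventually_gt_atTop 0)).exists
  refine ⟨s * A ^ γ, fun r hr => ?_⟩
  rcases le_total r A with h | h
  · have : s * r ^ γ ≤ s * A ^ γ := by gcongr
    nlinarith [mul_pos hκ hr]
  · have e : r ^ γ = r ^ (-(1 - γ)) * r := by
      rw [← Real.rpow_add_one hr.ne']; congr 1; ring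
    have h3 : r ^ (-(1 - γ)) ≤ A ^ (-(1 - γ)) :=
      Real.rpow_le_rpow_of_nonpos hA0 h (by linarith)
    have h4 : 0 ≤ s * A ^ γ := by positivity
    rw [e, ← mul_assoc]
    have : s * r ^ (-(1 - γ)) ≤ κ := (mul_le_mul_of_nonneg_left h3 hs).trans hA.le
    nlinarith

lemma wright_bound_s15 {γ : ℝ} (h0 : 0 < γ) (h1 : γ < 1) :
    ∃ C : ℝ, 0 ≤ C ∧ ∀ s : ℝ, 0 ≤ s → |wright γ s| ≤ C := by
  have hpi := Real.pi_pos
  set θ : ℝ := -(Real.pi * γ / 2) with hθ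
  set w : ℂ := Complex.exp (θ * Complex.I) with hw
  have hwre : w.re = Real.cos θ := by rw [hw, Complex.exp_ofReal_mul_I_re]
  have hθ1 : -(Real.pi / 2) < θ := by rw [hθ]; nlinarith
  have hθ2 : θ < 0 := by rw [hθ]; nlinarith [mul_pos hpi h0]
  have hκ : 0 < w.re := by
    rw [hwre]; exact Real.cos_pos_of_mem_Ioo ⟨hθ1, by linarith⟩
  set φ : ℝ := (Real.pi + θ) * γ with hφ
  set E : ℂ := Complex.exp (φ * Complex.I) with hE
  have hEre : 0 ≤ E.re := by
    rw [hE, Complex.exp_ofReal_mul_I_re]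
    refine Real.cos_nonneg_of_mem_Icc ⟨?_, ?_⟩
    · have : 0 ≤ φ := mul_nonneg (by linarith) h0.le
      linarith
    · rw [hφ, hθ]; nlinarith [mul_nonneg hpi.le (sq_nonneg (γ - 1))]
  have hEn : ‖E‖ = 1 := Complex.norm_exp_ofReal_mul_I φ
  set C := ∫ r in Set.Ioi (0:ℝ), r ^ (γ - 1) * Real.exp (-(w.re * r)) with hC
  have hC0 : 0 ≤ C := setIntegral_nonneg measurableSet_Ioi fun r hr => by
    have : (0:ℝ) < r := hr
    positivity
  refine ⟨C / Real.pi, by positivity, fun s hs => ?_⟩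
  -- the n-th integrand
  let F : ℕ → ℝ → ℂ := fun n r => ((-s : ℂ) ^ n / n.factorial * E ^ (n + 1)) *
    (((r ^ (γ * (n + 1) - 1) : ℝ) : ℂ) * Complex.exp (-(w * r)))
  let G : ℝ → ℂ := fun r => E * (((r ^ (γ - 1) : ℝ) : ℂ) * Complex.exp (-(w * r))) *
    Complex.exp (-s * E * ((r ^ γ : ℝ) : ℂ))
  have hpow : ∀ (n : ℕ) (r : ℝ), 0 < r → r ^ (γ * (n + 1) - 1) = r ^ (γ - 1) * (r ^ γ) ^ n := by
    intro n r hr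
    rw [← Real.rpow_natCast, ← Real.rpow_mul hr.le, ← Real.rpow_add hr]
    congr 1; ring
  let B : ℕ → ℝ → ℝ := fun n r => (r ^ (γ - 1) * Real.exp (-(w.re * r))) *
    ((s * r ^ γ) ^ n / n.factorial)
  have hBsum : ∀ r : ℝ, HasSum (fun n => B n r)
      ((r ^ (γ - 1) * Real.exp (-(w.re * r))) * Real.exp (s * r ^ γ)) := by
    intro r
    have := NormedSpace.expSeries_div_hasSum_exp (s * r ^ γ)
    rw [← Real.exp_eq_exp_ℝ] at this
    exact this.mul_left _
  have hsum : HasSum (fun n => ∫ r in Set.Ioi (0:ℝ), F n r) (∫ r in Set.Ioi (0:ℝ), G r) := by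
    refine hasSum_integral_of_dominated_convergence B ?_ ?_ ?_ ?_ ?_
    · intro n
      exact ((aux_meas _ w).const_mul _).aestronglyMeasurable
    · intro n
      filter_upwards [ae_restrict_mem measurableSet_Ioi] with r hr
      have hr' : (0:ℝ) < r := hr
      simp only [F, B]
      rw [norm_mul, aux_norm w hr', norm_mul, norm_pow, hEn, norm_div, norm_pow, norm_neg,
        Complex.norm_real, Real.norm_of_nonneg hs, hpow n r hr', Complex.norm_natCast]
      apply le_of_eq
      rw [mul_pow]; ring
    · exact Filter.Eventually.of_forall fun r => (hBsum r).summable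
    · simp_rw [fun r => (hBsum r).tsum_eq]
      obtain ⟨K, hK⟩ := aux_young h0 h1 hs (half_pos hκ)
      refine Integrable.mono' ((aux_integrable h0 (half_pos hκ)).const_mul (Real.exp K))
        (Measurable.aestronglyMeasurable (by fun_prop)) ?_
      filter_upwards [ae_restrict_mem measurableSet_Ioi] with r hr
      have hr' : (0:ℝ) < r := hr
      rw [Real.norm_of_nonneg (by positivity), mul_assoc, ← Real.exp_add, mul_left_comm,
        ← Real.exp_add]
      have := hK r hr'
      refine mul_le_mul_of_nonneg_left (Real.exp_le_exp.mpr ?_) (by positivity)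
      linarith
    · filter_upwards [ae_restrict_mem measurableSet_Ioi] with r hr
      have hr' : (0:ℝ) < r := hr
      have := NormedSpace.expSeries_div_hasSum_exp (-s * E * ((r ^ γ : ℝ) : ℂ))
      rw [← Complex.exp_eq_exp_ℂ] at this
      refine (this.mul_left (E * (((r ^ (γ - 1) : ℝ) : ℂ) * Complex.exp (-(w * r))))).congr_fun ?_
      intro n
      simp only [F]
      rw [hpow n r hr', mul_pow, mul_pow]
      push_cast
      ring
  have hterm : ∀ n : ℕ, (∫ r in Set.Ioi (0:ℝ), F n r).im / Real.pi
      = (-s) ^ n / (n.factorial * Real.Gamma (1 - γ - γ * n)) := by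
    intro n
    have ha : 0 < γ * ((n:ℝ) + 1) := by positivity
    simp only [F]
    rw [integral_const_mul, aux_gamma ha hκ]
    set a : ℝ := γ * ((n:ℝ) + 1) with hadef
    have hlog : Complex.log w = θ * Complex.I := by
      rw [hw, Complex.log_exp] <;> simp <;> linarith
    have hwa : w ^ (-(a:ℂ)) = Complex.exp (-(θ * a : ℝ) * Complex.I) := by
      rw [Complex.cpow_def_of_ne_zero (by rw [hw]; exact Complex.exp_ne_zero _), hlog]
      congr 1; push_cast; ring
    have hEw : E ^ (n + 1) * w ^ (-(a:ℂ)) = Complex.exp ((Real.pi * a : ℝ) * Complex.I) := by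
      rw [hwa, hE, ← Complex.exp_nat_mul, ← Complex.exp_add]
      congr 1
      rw [hadef, hφ]
      push_cast
      ring
    have e1 : ((-s : ℂ) ^ n / n.factorial * E ^ (n + 1)) * (w ^ (-(a:ℂ)) * Real.Gamma a)
        = (((-s) ^ n / n.factorial * Real.Gamma a : ℝ) : ℂ) *
          Complex.exp ((Real.pi * a : ℝ) * Complex.I) := by
      rw [← hEw]; push_cast; ring
    rw [e1, Complex.im_ofReal_mul, Complex.exp_ofReal_mul_I_im]
    have hrefl := Real.Gamma_mul_Gamma_one_sub a
    have hG : Real.Gamma a ≠ 0 := (Real.Gamma_pos_of_pos ha).ne'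
    have hG2 : Real.Gamma (1 - γ - γ * n) = Real.pi / Real.sin (Real.pi * a) / Real.Gamma a := by
      rw [eq_div_iff hG, ← hrefl, mul_comm, hadef]
      congr 2; ring
    rw [hG2]
    simp only [div_eq_mul_inv, mul_inv, inv_inv]
    ring
  have hw2 : wright γ s = (∫ r in Set.Ioi (0:ℝ), G r).im / Real.pi := by
    have := (Complex.hasSum_im hsum).div_const Real.pi
    simp_rw [hterm] at this
    exact this.tsum_eq
  rw [hw2, abs_div, abs_of_pos hpi]
  gcongr
  refine (Complex.abs_im_le_norm _).trans ?_
  refine norm_integral_le_of_norm_le (aux_integrable h0 hκ) ?_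
  filter_upwards [ae_restrict_mem measurableSet_Ioi] with r hr
  have hr' : (0:ℝ) < r := hr
  simp only [G]
  rw [norm_mul, norm_mul, hEn, one_mul, aux_norm w hr', Complex.norm_exp]
  refine mul_le_of_le_one_right (by positivity) ?_
  rw [Real.exp_le_one_iff, Complex.re_mul_ofReal, ← Complex.ofReal_neg, Complex.re_ofReal_mul]
  have : 0 ≤ s * E.re * r ^ γ := by positivity
  linarith

/-- If `‖T(t)‖ ≤ M₀ e^{-ct} t^{β-1}` for `t > 0`, and
`P_γ(t)x = γ ∫_0^∞ s Φ_γ(s) T(s t^γ) x ds`, then there is `M₂ > 0` with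
`‖P_γ(t)‖ ≤ M₂ t^{-2γ}` for all `t ≥ 1`. -/
theorem Pgamma_estimate {X : Type*} [NormedAddCommGroup X] [NormedSpace ℝ X] [CompleteSpace X]
    (γ β c M₀ : ℝ) (hγ : γ ∈ Set.Ioo (0:ℝ) 1) (hβ : β ∈ Set.Ioc (0:ℝ) 1)
    (hc : 0 < c) (hM₀ : 0 < M₀)
    (T : ℝ → X →L[ℝ] X)
    (hTcont : ∀ x : X, ContinuousOn (fun t => T t x) (Set.Ioi 0))
    (hT : ∀ t > (0:ℝ), ‖T t‖ ≤ M₀ * Real.exp (-c * t) * t ^ (β - 1)) :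
    ∃ M₂ > (0:ℝ), ∀ t ≥ (1:ℝ), ∀ x : X,
      ‖γ • ∫ s in Set.Ioi (0:ℝ), (s * wright γ s) • T (s * t ^ γ) x‖ ≤
        M₂ * t ^ (-(2 * γ)) * ‖x‖ := by
  obtain ⟨h0, h1⟩ := hγ
  obtain ⟨hb0, hb1⟩ := hβ
  obtain ⟨C, hC0, hC⟩ := wright_bound_s15 h0 h1
  set D : ℝ := γ * (C * M₀ * ((1 / c) ^ (β + 1) * Real.Gamma (β + 1))) with hD
  have hGam : 0 < Real.Gamma (β + 1) := Real.Gamma_pos_of_pos (by linarith)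
  have hD0 : 0 ≤ D := by positivity
  refine ⟨D + 1, by positivity, fun t ht x => ?_⟩
  have ht0 : 0 < t := by linarith
  set τ : ℝ := t ^ γ with hτ
  have hτ0 : 0 < τ := by positivity
  have hcτ : 0 < c * τ := by positivity
  have hmain : ‖∫ s in Set.Ioi (0:ℝ), (s * wright γ s) • T (s * τ) x‖ ≤
      ∫ s in Set.Ioi (0:ℝ), (C * M₀ * τ ^ (β - 1) * ‖x‖) *
        (s ^ ((β + 1) - 1) * Real.exp (-(c * τ * s))) := by
    refine norm_integral_le_of_norm_le
      ((aux_integrable (by linarith) hcτ).const_mul _) ?_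
    filter_upwards [ae_restrict_mem measurableSet_Ioi] with s hs
    have hs' : (0:ℝ) < s := hs
    rw [norm_smul, norm_mul, Real.norm_of_nonneg hs'.le, Real.norm_eq_abs]
    have hTx : ‖T (s * τ) x‖ ≤
        (M₀ * Real.exp (-c * (s * τ)) * (s * τ) ^ (β - 1)) * ‖x‖ :=
      (T (s * τ)).le_of_opNorm_le (hT _ (by positivity)) x
    calc s * |wright γ s| * ‖T (s * τ) x‖
        ≤ s * C * ((M₀ * Real.exp (-c * (s * τ)) * (s * τ) ^ (β - 1)) * ‖x‖) := by
          gcongr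
          exact hC s hs'.le
      _ = _ := by
          rw [Real.mul_rpow hs'.le hτ0.le, show β + 1 - 1 = (β - 1) + 1 by ring,
            Real.rpow_add_one hs'.ne', show -c * (s * τ) = -(c * τ * s) by ring]
          ring
  rw [integral_const_mul, Real.integral_rpow_mul_exp_neg_mul_Ioi (by linarith) hcτ] at hmain
  have hpow : τ ^ (β - 1) * (1 / (c * τ)) ^ (β + 1) = (1 / c) ^ (β + 1) * t ^ (-(2 * γ)) := by
    have e : t ^ (-(2 * γ)) = τ ^ (-2 : ℝ) := by
      rw [hτ, ← Real.rpow_mul ht0.le]; congr 1; ring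
    rw [e, one_div, mul_inv, Real.mul_rpow (by positivity) (by positivity), one_div,
      Real.inv_rpow hτ0.le, ← Real.rpow_neg hτ0.le, mul_left_comm, ← Real.rpow_add hτ0]
    congr 2; ring
  rw [norm_smul, Real.norm_of_nonneg h0.le]
  calc γ * ‖∫ s in Set.Ioi (0:ℝ), (s * wright γ s) • T (s * τ) x‖
      ≤ γ * (C * M₀ * τ ^ (β - 1) * ‖x‖ * ((1 / (c * τ)) ^ (β + 1) * Real.Gamma (β + 1))) := by
        gcongr
    _ = γ * (C * M₀ * Real.Gamma (β + 1)) * (τ ^ (β - 1) * (1 / (c * τ)) ^ (β + 1)) * ‖x‖ := by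
        ring
    _ = D * t ^ (-(2 * γ)) * ‖x‖ := by rw [hpow, hD]; ring
    _ ≤ (D + 1) * t ^ (-(2 * γ)) * ‖x‖ := by
        gcongr
        linarith
end
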